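/- The Chern number of the four-fold degenerate flat band equals −1: In the setting of the two-fold degenerate Gramian (see context), with H(k) := ∂_k̄ ∂_k log g(k) for k ∈ ℂ∖Λ*, one has lim_{ε→0⁺} ∫_{F_{Λ*}∖D(0,ε)} H(k) dm(k) = π, where F_{Λ*} := {s·q₁ + t·q₂ : s,t ∈ (−1/2, 1/2)} with q₁ := 4πi/√3 and q₂ := (4πi/√3)·ω is a fundamental domain of Λ* centered at 0, D(0,ε) is the open disc of radius ε about 0, and dm is Lebesgue measure. Equivalently, the first Chern number c₁(E) = (i/2π)∫ tr Θ of the rank-two holomorphic vector bundle E of flat-band Bloch functions equals −1. -/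

import Mathlib

noncomputable section

open Complex MeasureTheory

namespace TBG

/-- `ω = exp(2πi/3)`. -/
def ω : ℂ := Complex.exp (2 * Real.pi * Complex.I / 3)

/-- The moiré lattice `Λ = ℤω + ℤ ⊂ ℂ`. -/
def Λ : Set ℂ := {z : ℂ | ∃ m n : ℤ, z = m * ω + n}

/-- The dual lattice `Λ* = (4πi/√3)·Λ`. -/
def Λdual : Set ℂ := {p : ℂ | ∃ m n : ℤ, p = 4 * Real.pi * Complex.I / Real.sqrt 3 * (m * ω + n)}

/-- The high symmetry point `K = 4π/3`. -/
def K : ℂ := 4 * Real.pi / 3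

/-- `⟨z,w⟩ = Re (z · conj w)`. -/
def pair (z w : ℂ) : ℝ := (z * (starRingEnd ℂ) w).re

/-- `2 D_z̄ f = (1/i)(∂_x f + i ∂_y f)`. -/
def Dbar (f : ℂ → ℂ) (z : ℂ) : ℂ :=
  1 / Complex.I * (fderiv ℝ f z 1 + Complex.I * fderiv ℝ f z Complex.I)

/-- A tunnelling potential: smooth, with the translational and rotational symmetries. -/
def IsTunnelling (U : ℂ → ℂ) : Prop :=
  ContDiff ℝ (⊤ : ℕ∞) U ∧
    (∀ γ ∈ Λ, ∀ z : ℂ, U (z + γ) = Complex.exp (Complex.I * (pair γ K : ℂ)) * U z) ∧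
    ∀ z : ℂ, U (ω * z) = ω * U z

/-- Membership in `ker_{L²₀}(D(α)+k)` for the chiral model with tunnelling
potentials `U₊ = Up`, `U₋ = Um`: smooth solutions of `(D(α)+k)u = 0` with the
Floquet boundary conditions. -/
def InKer (Up Um : ℂ → ℂ) (α k : ℂ) (u : ℂ → ℂ × ℂ) : Prop :=
  ContDiff ℝ (⊤ : ℕ∞) u ∧
    (∀ z : ℂ, Dbar (fun w => (u w).1) z + k * (u z).1 + α * Up z * (u z).2 = 0) ∧
    (∀ z : ℂ, Dbar (fun w => (u w).2) z + k * (u z).2 + α * Um z * (u z).1 = 0) ∧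
    (∀ γ ∈ Λ, ∀ z : ℂ, (u (z + γ)).1 = Complex.exp (-Complex.I * (pair γ K : ℂ)) * (u z).1) ∧
    (∀ γ ∈ Λ, ∀ z : ℂ, (u (z + γ)).2 = Complex.exp (Complex.I * (pair γ K : ℂ)) * (u z).2)

/-- `Ker(α,k)` as a set of functions. -/
def kerSet (Up Um : ℂ → ℂ) (α k : ℂ) : Set (ℂ → ℂ × ℂ) := {u | InKer Up Um α k u}

/-- `dim_ℂ Ker(α,k)` (the set `Ker(α,k)` is a linear subspace, so the finrank of its span
is its dimension). -/
def kerDim (Up Um : ℂ → ℂ) (α k : ℂ) : ℕ :=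
  Module.finrank ℂ ↥(Submodule.span ℂ (kerSet Up Um α k))

/-- `Ker_p(α) = {u ∈ Ker(α,0) : u(ωz) = ω^(−p)·u(z)}`. -/
def kerPSet (Up Um : ℂ → ℂ) (α : ℂ) (p : ℕ) : Set (ℂ → ℂ × ℂ) :=
  {u | u ∈ kerSet Up Um α 0 ∧ ∀ z : ℂ, u (ω * z) = (ω ^ (-(p : ℤ))) • u z}

/-- `dim_ℂ Ker_p(α)`. -/
def kerPDim (Up Um : ℂ → ℂ) (α : ℂ) (p : ℕ) : ℕ :=
  Module.finrank ℂ ↥(Submodule.span ℂ (kerPSet Up Um α p))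

/-- `α` is magic: the flat band condition `Ker(α,k) ≠ {0}` for every `k`. -/
def IsMagic (Up Um : ℂ → ℂ) (α : ℂ) : Prop :=
  ∀ k : ℂ, ∃ u ∈ kerSet Up Um α k, u ≠ 0


/-- The stacking point `z_S = i/√3`. -/
def zS : ℂ := Complex.I / Real.sqrt 3

/-- Jacobi's theta function `θ₁(ζ|ω)`. -/
def theta (ζ : ℂ) : ℂ :=
  -∑' n : ℤ, Complex.exp (Real.pi * Complex.I * ((n : ℂ) + 1 / 2) ^ 2 * ω +
      2 * Real.pi * Complex.I * ((n : ℂ) + 1 / 2) * (ζ + 1 / 2))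

/-- `z(k) = √3·k/(4πi)`. -/
def zmap (k : ℂ) : ℂ := Real.sqrt 3 * k / (4 * Real.pi * Complex.I)

/-- `F_k(z) = exp((i/2)(z−conj z)k)·θ(z−z(k))/θ(z)`. -/
def Fk (k z : ℂ) : ℂ :=
  Complex.exp (Complex.I / 2 * (z - (starRingEnd ℂ) z) * k) * theta (z - zmap k) / theta z

/-- A fundamental domain of `Λ`: `{s + tω : s,t ∈ [0,1)}`. -/
def FΛ : Set ℂ := {z : ℂ | ∃ s t : ℝ, 0 ≤ s ∧ s < 1 ∧ 0 ≤ t ∧ t < 1 ∧ z = s + t * ω}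

/-- The Wirtinger derivative `∂_k`. -/
def dk (f : ℂ → ℂ) (k : ℂ) : ℂ := (fderiv ℝ f k 1 - Complex.I * fderiv ℝ f k Complex.I) / 2

/-- The Wirtinger derivative `∂_k̄`. -/
def dkbar (f : ℂ → ℂ) (k : ℂ) : ℂ := (fderiv ℝ f k 1 + Complex.I * fderiv ℝ f k Complex.I) / 2

/-- A fundamental domain of `Λ*` centered at `0`:
`{s·q₁ + t·q₂ : s,t ∈ (−1/2,1/2)}`, `q₁ = 4πi/√3`, `q₂ = q₁·ω`. -/
def FΛdual : Set ℂ :=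
  {k : ℂ | ∃ s t : ℝ, -(1 / 2) < s ∧ s < 1 / 2 ∧ -(1 / 2) < t ∧ t < 1 / 2 ∧
    k = s * (4 * Real.pi * Complex.I / Real.sqrt 3) +
      t * (4 * Real.pi * Complex.I / Real.sqrt 3 * ω)}

lemma omega_eq : ω = -1 / 2 + (Real.sqrt 3 / 2 : ℝ) * I := by
  have h : (2 * Real.pi * I / 3 : ℂ) = ((2 * Real.pi / 3 : ℝ) : ℂ) * I := by push_cast; ring
  have h2 : (2 * Real.pi / 3 : ℝ) = Real.pi - Real.pi / 3 := by ring
  rw [ω, h, exp_mul_I, ← ofReal_cos, ← ofReal_sin, h2, Real.cos_pi_sub, Real.sin_pi_sub,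
    Real.cos_pi_div_three, Real.sin_pi_div_three]
  push_cast; ring

lemma omega_re : ω.re = -1 / 2 := by
  rw [omega_eq]; simp [-ofReal_div]

lemma omega_im : ω.im = Real.sqrt 3 / 2 := by
  rw [omega_eq]; simp [-ofReal_div]

lemma omega_im_pos : 0 < ω.im := by rw [omega_im]; positivity

lemma theta_term_eq (n : ℤ) (ζ : ℂ) :
    Complex.exp (Real.pi * Complex.I * ((n : ℂ) + 1 / 2) ^ 2 * ω +
      2 * Real.pi * Complex.I * ((n : ℂ) + 1 / 2) * (ζ + 1 / 2)) =
    Complex.exp (Real.pi * I * ω / 4 + Real.pi * I * (ζ + 1 / 2)) *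
      jacobiTheta₂_term n (ζ + 1 / 2 + ω / 2) ω := by
  rw [jacobiTheta₂_term, ← Complex.exp_add]
  congr 1; ring

lemma theta_eq (ζ : ℂ) : theta ζ =
    -(Complex.exp (Real.pi * I * ω / 4 + Real.pi * I * (ζ + 1 / 2)) *
      jacobiTheta₂ (ζ + 1 / 2 + ω / 2) ω) := by
  simp_rw [theta, theta_term_eq, tsum_mul_left, jacobiTheta₂]

lemma summable_theta_term (ζ : ℂ) : Summable fun n : ℤ =>
    Complex.exp (Real.pi * Complex.I * ((n : ℂ) + 1 / 2) ^ 2 * ω +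
      2 * Real.pi * Complex.I * ((n : ℂ) + 1 / 2) * (ζ + 1 / 2)) := by
  simp_rw [theta_term_eq]
  exact ((summable_jacobiTheta₂_term_iff _ _).2 omega_im_pos).mul_left _

lemma differentiable_theta : Differentiable ℂ theta := by
  have h : theta = fun ζ => -(Complex.exp (Real.pi * I * ω / 4 + Real.pi * I * (ζ + 1 / 2)) *
      jacobiTheta₂ (ζ + 1 / 2 + ω / 2) ω) := funext theta_eq
  rw [h]
  intro ζ
  have h2 : DifferentiableAt ℂ (fun ζ => jacobiTheta₂ (ζ + 1 / 2 + ω / 2) ω) ζ :=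
    (differentiableAt_jacobiTheta₂_fst (ζ + 1 / 2 + ω / 2) omega_im_pos).comp
      (f := fun ζ : ℂ => ζ + 1 / 2 + ω / 2) ζ (by fun_prop)
  fun_prop

lemma theta_add_one (ζ : ℂ) : theta (ζ + 1) = -theta ζ := by
  rw [theta_eq, theta_eq, show ζ + 1 + 1 / 2 + ω / 2 = (ζ + 1 / 2 + ω / 2) + 1 by ring,
    jacobiTheta₂_add_left, show (Real.pi * I * ω / 4 + Real.pi * I * (ζ + 1 + 1 / 2) : ℂ) =
      (Real.pi * I * ω / 4 + Real.pi * I * (ζ + 1 / 2)) + Real.pi * I by ring,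
    Complex.exp_add _ (Real.pi * I : ℂ), exp_pi_mul_I]
  ring

lemma theta_add_omega (ζ : ℂ) :
    theta (ζ + ω) = -Complex.exp (-Real.pi * I * ω - 2 * Real.pi * I * ζ) * theta ζ := by
  rw [theta_eq, theta_eq, show ζ + ω + 1 / 2 + ω / 2 = (ζ + 1 / 2 + ω / 2) + ω by ring,
    jacobiTheta₂_add_left', ← mul_assoc, ← Complex.exp_add]
  have h : -Complex.exp (-Real.pi * I * ω - 2 * Real.pi * I * ζ) =
      Complex.exp (-Real.pi * I * ω - 2 * Real.pi * I * ζ + -(Real.pi * I)) := by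
    rw [Complex.exp_add _ (-(Real.pi * I : ℂ)), exp_neg_pi_mul_I]; ring
  rw [h, mul_neg, ← mul_assoc, ← Complex.exp_add]
  congr 2; congr 1; ring

lemma theta_sub_one (ζ : ℂ) : theta (ζ - 1) = -theta ζ := by
  have := theta_add_one (ζ - 1)
  rw [sub_add_cancel] at this
  rw [this, neg_neg]

lemma theta_sub_omega (ζ : ℂ) :
    theta (ζ - ω) = -Complex.exp (-Real.pi * I * ω + 2 * Real.pi * I * ζ) * theta ζ := by
  have := theta_add_omega (ζ - ω)
  rw [sub_add_cancel] at this
  rw [this, ← mul_assoc, neg_mul_neg, ← Complex.exp_add]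
  ring_nf
  simp

/-- The theta series with the terms of index `n` and `-1-n` grouped together. -/
lemma hasSum_theta (ζ : ℂ) : HasSum (fun n : ℕ =>
    Complex.exp (Real.pi * I * ((n : ℂ) + 1 / 2) ^ 2 * ω) *
      (Complex.exp (Real.pi * I * (ζ + 1 / 2)) ^ (2 * n + 1) +
        (Complex.exp (Real.pi * I * (ζ + 1 / 2)))⁻¹ ^ (2 * n + 1))) (-theta ζ) := by
  have h := (summable_theta_term ζ).hasSum.nat_add_neg_add_one
  rw [theta, neg_neg]
  convert h using 2 with n
  rw [← Complex.exp_neg, ← Complex.exp_nat_mul, ← Complex.exp_nat_mul, mul_add,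
    ← Complex.exp_add, ← Complex.exp_add]
  push_cast
  congr 2 <;> ring

lemma theta_zero : theta 0 = 0 := by
  have h := hasSum_theta 0
  have h2 : Complex.exp (Real.pi * I * (0 + 1 / 2)) = I := by
    rw [show (Real.pi * I * (0 + 1 / 2) : ℂ) = Real.pi / 2 * I by ring, exp_pi_div_two_mul_I]
  have h3 : ∀ n : ℕ, I ^ (2 * n + 1) + I⁻¹ ^ (2 * n + 1) = 0 := by
    intro n
    rw [inv_I, neg_pow I, Odd.neg_one_pow ⟨n, rfl⟩]; ring
  simp_rw [h2, h3, mul_zero] at h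
  simpa using (h.unique hasSum_zero)

lemma norm_odd_pow_add_inv_le {u : ℂ} (hu : u ≠ 0) {B : ℝ} (hB : 1 ≤ B) (h1 : ‖u‖ ^ 2 ≤ B)
    (h2 : ‖u⁻¹‖ ^ 2 ≤ B) (n : ℕ) :
    ‖u ^ (2 * n + 1) + u⁻¹ ^ (2 * n + 1)‖ ≤ (2 * n + 1) * B ^ n * ‖u + u⁻¹‖ := by
  induction n with
  | zero => simp
  | succ n ih =>
    have key : u ^ (2 * (n + 1) + 1) + u⁻¹ ^ (2 * (n + 1) + 1) =
        -(u ^ (2 * n + 1) + u⁻¹ ^ (2 * n + 1)) +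
          (u + u⁻¹) * ((u ^ 2) ^ (n + 1) + (u⁻¹ ^ 2) ^ (n + 1)) := by
      have hu1 : u * u⁻¹ = 1 := mul_inv_cancel₀ hu
      generalize u⁻¹ = v at hu1
      simp only [← pow_mul]
      have e1 : u * v ^ (2 * (n + 1)) = v ^ (2 * n + 1) := by
        rw [show 2 * (n + 1) = (2 * n + 1) + 1 by ring, pow_succ v (2 * n + 1)]
        linear_combination v ^ (2 * n + 1) * hu1
      have e2 : v * u ^ (2 * (n + 1)) = u ^ (2 * n + 1) := by
        rw [show 2 * (n + 1) = (2 * n + 1) + 1 by ring, pow_succ u (2 * n + 1)]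
        linear_combination u ^ (2 * n + 1) * hu1
      rw [show (u + v) * (u ^ (2 * (n + 1)) + v ^ (2 * (n + 1))) =
        u * u ^ (2 * (n + 1)) + u * v ^ (2 * (n + 1)) + v * u ^ (2 * (n + 1)) +
          v * v ^ (2 * (n + 1)) by ring, e1, e2]
      ring
    have hB0 : B ^ n ≤ B ^ (n + 1) := pow_le_pow_right₀ hB (Nat.le_succ n)
    have hs : ‖(u ^ 2) ^ (n + 1) + (u⁻¹ ^ 2) ^ (n + 1)‖ ≤ 2 * B ^ (n + 1) := by
      calc _ ≤ ‖(u ^ 2) ^ (n + 1)‖ + ‖(u⁻¹ ^ 2) ^ (n + 1)‖ := norm_add_le _ _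
        _ ≤ B ^ (n + 1) + B ^ (n + 1) := by
          simp only [norm_pow]
          gcongr
        _ = _ := by ring
    have hc : 0 ≤ ‖u + u⁻¹‖ := norm_nonneg _
    calc _ ≤ ‖u ^ (2 * n + 1) + u⁻¹ ^ (2 * n + 1)‖ +
          ‖u + u⁻¹‖ * ‖(u ^ 2) ^ (n + 1) + (u⁻¹ ^ 2) ^ (n + 1)‖ := by
          rw [key, ← norm_mul, ← norm_neg (u ^ (2 * n + 1) + u⁻¹ ^ (2 * n + 1))]
          exact norm_add_le _ _
      _ ≤ (2 * n + 1) * B ^ (n + 1) * ‖u + u⁻¹‖ + ‖u + u⁻¹‖ * (2 * B ^ (n + 1)) := by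
          gcongr
          exact ih.trans (by gcongr)
      _ = _ := by push_cast; ring

lemma norm_exp_theta_coeff (n : ℕ) :
    ‖Complex.exp (Real.pi * I * ((n : ℂ) + 1 / 2) ^ 2 * ω)‖ =
      Real.exp (-(Real.pi * Real.sqrt 3 / 8)) *
        Real.exp (-(Real.pi * Real.sqrt 3 / 2)) ^ (n ^ 2 + n) := by
  rw [Complex.norm_exp, ← Real.exp_nat_mul, ← Real.exp_add]
  congr 1
  have : (Real.pi * I * ((n : ℂ) + 1 / 2) ^ 2 * ω : ℂ) =
      ((Real.pi * ((n : ℝ) + 1 / 2) ^ 2 : ℝ) : ℂ) * (I * ω) := by push_cast; ring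
  rw [this, re_ofReal_mul, I_mul_re, omega_im]
  push_cast; ring

lemma exp_neg_pi_sqrt_three_le : Real.exp (-(Real.pi * Real.sqrt 3 / 2)) ≤ 1 / 7 := by
  have h3 : (1.7 : ℝ) ≤ Real.sqrt 3 := Real.le_sqrt_of_sq_le (by norm_num)
  have hpi := Real.pi_gt_three
  have h4 : (2 : ℝ) ≤ Real.pi * Real.sqrt 3 / 2 := by nlinarith
  have h1 := Real.exp_one_gt_d9
  have h7 : (7 : ℝ) ≤ Real.exp (Real.pi * Real.sqrt 3 / 2) := by
    calc (7 : ℝ) ≤ Real.exp 1 * Real.exp 1 := by nlinarith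
      _ = Real.exp 2 := by rw [← Real.exp_add]; norm_num
      _ ≤ _ := Real.exp_le_exp.2 h4
  rw [Real.exp_neg, one_div]
  exact inv_anti₀ (by norm_num) h7

lemma theta_lower_bound {ζ : ℂ} (hζ : |ζ.im| ≤ Real.sqrt 3 / 4) :
    Real.exp (-(Real.pi * Real.sqrt 3 / 8)) / 2 * ‖Complex.sin (Real.pi * ζ)‖ ≤ ‖theta ζ‖ := by
  set u := Complex.exp (Real.pi * I * (ζ + 1 / 2)) with hu
  set r := Real.exp (-(Real.pi * Real.sqrt 3 / 2)) with hr
  set A := Real.exp (-(Real.pi * Real.sqrt 3 / 8)) with hA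
  have hr0 : 0 < r := Real.exp_pos _
  have hA0 : 0 < A := Real.exp_pos _
  have hr7 : r ≤ 1 / 7 := exp_neg_pi_sqrt_three_le
  have hu0 : u ≠ 0 := Complex.exp_ne_zero _
  have hre : (Real.pi * I * (ζ + 1 / 2) : ℂ).re = -(Real.pi * ζ.im) := by
    rw [mul_assoc, re_ofReal_mul, I_mul_re]; simp
  have hc0 : u + u⁻¹ = -2 * Complex.sin (Real.pi * ζ) := by
    rw [hu, ← Complex.exp_neg, show (Real.pi * I * (ζ + 1 / 2) : ℂ) =
      (Real.pi * ζ + Real.pi / 2) * I by ring, ← neg_mul, ← Complex.two_cos,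
      Complex.cos_add_pi_div_two]
    ring
  set B := Real.exp (2 * Real.pi * |ζ.im|) with hB
  have hB1 : 1 ≤ B := Real.one_le_exp (by positivity)
  have hun : ‖u‖ ^ 2 ≤ B := by
    rw [hu, Complex.norm_exp, ← Real.exp_nat_mul, hB, hre]
    apply Real.exp_le_exp.2
    push_cast
    nlinarith [neg_abs_le ζ.im, Real.pi_pos]
  have hvn : ‖u⁻¹‖ ^ 2 ≤ B := by
    rw [hu, ← Complex.exp_neg, Complex.norm_exp, ← Real.exp_nat_mul, hB, neg_re, hre]
    apply Real.exp_le_exp.2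
    push_cast
    nlinarith [le_abs_self ζ.im, Real.pi_pos]
  have hBr : B * r ≤ 1 := by
    rw [hB, hr, ← Real.exp_add]
    apply Real.exp_le_one_iff.2
    nlinarith [Real.pi_pos]
  have hsum := hasSum_theta ζ
  rw [← hu] at hsum
  set a : ℕ → ℂ := fun n => Complex.exp (Real.pi * I * ((n : ℂ) + 1 / 2) ^ 2 * ω) *
      (u ^ (2 * n + 1) + u⁻¹ ^ (2 * n + 1)) with ha
  set c := ‖u + u⁻¹‖ with hc
  have hcn : 0 ≤ c := norm_nonneg _
  have ha0 : ‖a 0‖ = A * c := by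
    simp only [ha, norm_mul, norm_exp_theta_coeff]
    simp [hA, hc]
  have hbound : ∀ n : ℕ, ‖a (n + 1)‖ ≤ A * c * (3 / 7) * (3 / 7) ^ n := by
    intro n
    have h1 := norm_odd_pow_add_inv_le hu0 hB1 hun hvn (n + 1)
    have h3 : ((2 * ((n + 1 : ℕ) : ℝ) + 1)) ≤ 3 ^ (n + 1) := by
      have := one_add_mul_le_pow (a := (2 : ℝ)) (by norm_num) (n + 1)
      norm_num at this ⊢
      linarith
    have h4 : r ^ ((n + 1) ^ 2) ≤ (1 / 7) ^ (n + 1) := by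
      calc r ^ ((n + 1) ^ 2) ≤ r ^ (n + 1) :=
            pow_le_pow_of_le_one hr0.le (hr7.trans (by norm_num)) (Nat.le_self_pow (by norm_num) _)
        _ ≤ _ := by gcongr
    have h5 : B ^ (n + 1) * r ^ (n + 1) ≤ 1 := by
      rw [← mul_pow]; exact pow_le_one₀ (by positivity) hBr
    simp only [ha, norm_mul, norm_exp_theta_coeff]
    rw [← hA, ← hr]
    calc A * r ^ ((n + 1) ^ 2 + (n + 1)) * ‖u ^ (2 * (n + 1) + 1) + u⁻¹ ^ (2 * (n + 1) + 1)‖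
        ≤ A * r ^ ((n + 1) ^ 2 + (n + 1)) *
          ((2 * ((n + 1 : ℕ) : ℝ) + 1) * B ^ (n + 1) * c) := by gcongr
      _ = A * c * (2 * ((n + 1 : ℕ) : ℝ) + 1) * r ^ ((n + 1) ^ 2) *
          (B ^ (n + 1) * r ^ (n + 1)) := by rw [pow_add]; ring
      _ ≤ A * c * 3 ^ (n + 1) * (1 / 7) ^ (n + 1) * 1 := by gcongr
      _ = A * c * (3 / 7) * (3 / 7) ^ n := by
        rw [mul_one, mul_assoc (A * c), ← mul_pow]; norm_num; ring
  have hgeo : HasSum (fun n : ℕ => A * c * (3 / 7) * (3 / 7 : ℝ) ^ n)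
      (A * c * (3 / 7) * (1 - 3 / 7)⁻¹) :=
    (hasSum_geometric_of_lt_one (by norm_num) (by norm_num)).mul_left _
  have htail : ‖∑' n, a (n + 1)‖ ≤ A * c * (3 / 4) := by
    refine (tsum_of_norm_bounded hgeo hbound).trans (le_of_eq ?_)
    norm_num; ring
  have hsplit : -theta ζ = a 0 + ∑' n, a (n + 1) := by
    rw [← hsum.tsum_eq, hsum.summable.tsum_eq_zero_add]
  have hcs : c = 2 * ‖Complex.sin (Real.pi * ζ)‖ := by
    rw [hc, hc0]; simp
  have : ‖a 0‖ - ‖∑' n, a (n + 1)‖ ≤ ‖theta ζ‖ := by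
    rw [← norm_neg (theta ζ), hsplit]
    have := norm_sub_norm_le (a 0) (-∑' n, a (n + 1))
    rwa [norm_neg, sub_neg_eq_add] at this
  rw [ha0] at this
  rw [hcs] at this htail
  linarith

lemma theta_add_int_mul_omega_eq_zero {ζ : ℂ} (m : ℤ) (h : theta ζ = 0) :
    theta (ζ + m * ω) = 0 := by
  induction m with
  | zero => simpa using h
  | succ n ih =>
    rw [show ζ + ((n + 1 : ℤ) : ℂ) * ω = ζ + ((n : ℤ) : ℂ) * ω + ω by push_cast; ring,
      theta_add_omega, ih, mul_zero]
  | pred n ih =>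
    rw [show ζ + ((-n - 1 : ℤ) : ℂ) * ω = ζ + ((-n : ℤ) : ℂ) * ω - ω by push_cast; ring,
      theta_sub_omega, ih, mul_zero]

lemma mem_lattice_of_theta_eq_zero {ζ : ℂ} (h : theta ζ = 0) : ζ ∈ Λ := by
  set m : ℤ := round (ζ.im / (Real.sqrt 3 / 2)) with hm
  have hs : (0 : ℝ) < Real.sqrt 3 / 2 := by positivity
  have h1 : theta (ζ + (-m : ℤ) * ω) = 0 := theta_add_int_mul_omega_eq_zero _ h
  have him : (ζ + (-m : ℤ) * ω).im = ζ.im - m * (Real.sqrt 3 / 2) := by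
    have : ((-m : ℤ) : ℂ) = ((-m : ℝ) : ℂ) := by push_cast; ring
    rw [this, add_im, im_ofReal_mul, omega_im]; ring
  have h2 : |(ζ + (-m : ℤ) * ω).im| ≤ Real.sqrt 3 / 4 := by
    have := abs_sub_round (ζ.im / (Real.sqrt 3 / 2))
    rw [him]
    rw [← hm] at this
    have e : ζ.im - m * (Real.sqrt 3 / 2) =
        (ζ.im / (Real.sqrt 3 / 2) - m) * (Real.sqrt 3 / 2) := by field_simp
    rw [e, abs_mul, abs_of_pos hs]
    nlinarith
  have h3 := theta_lower_bound h2
  rw [h1, norm_zero] at h3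
  have h4 : Complex.sin (Real.pi * (ζ + (-m : ℤ) * ω)) = 0 := by
    have : 0 < Real.exp (-(Real.pi * Real.sqrt 3 / 8)) / 2 := by positivity
    exact norm_le_zero_iff.1 (by nlinarith [norm_nonneg (Complex.sin (Real.pi * (ζ + (-m : ℤ) * ω)))])
  obtain ⟨n, hn⟩ := Complex.sin_eq_zero_iff.1 h4
  refine ⟨m, n, ?_⟩
  have hpi : (Real.pi : ℂ) ≠ 0 := ofReal_ne_zero.2 Real.pi_ne_zero
  have : ζ + (-m : ℤ) * ω = n := mul_left_cancel₀ hpi (by rw [hn]; ring)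
  push_cast at this
  linear_combination this

lemma deriv_theta_zero_ne_zero : deriv theta 0 ≠ 0 := by
  intro h
  have h1 : HasDerivAt theta 0 0 := by
    simpa only [h] using (differentiable_theta 0).hasDerivAt
  have h2 : HasDerivAt (fun ζ : ℂ => Complex.sin (Real.pi * ζ)) Real.pi 0 := by
    have := ((hasDerivAt_id (0 : ℂ)).const_mul (Real.pi : ℂ)).csin
    simpa using this
  rw [hasDerivAt_iff_tendsto_slope] at h1 h2
  have hA : 0 < Real.exp (-(Real.pi * Real.sqrt 3 / 8)) / 2 := by positivity
  have h3 := (h2.norm.const_mul (Real.exp (-(Real.pi * Real.sqrt 3 / 8)) / 2))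
  have h4 := le_of_tendsto_of_tendsto h3 h1.norm ?_
  · rw [norm_zero] at h4
    have : 0 < ‖(Real.pi : ℂ)‖ := by simp [Real.pi_ne_zero]
    nlinarith [mul_pos hA this]
  · apply Filter.Eventually.filter_mono nhdsWithin_le_nhds
    filter_upwards [Metric.ball_mem_nhds (0 : ℂ) (show 0 < Real.sqrt 3 / 4 by positivity)] with ζ hζ
    have hz : |ζ.im| ≤ Real.sqrt 3 / 4 :=
      (abs_im_le_norm ζ).trans (by simpa using (Metric.mem_ball.1 hζ).le)
    have := theta_lower_bound hz
    simp only [slope_def_field, norm_div, theta_zero, sub_zero, mul_zero, Complex.sin_zero]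
    rw [← mul_div_assoc]
    gcongr

open scoped InnerProductSpace

section Curve
variable {X : Type*} [TopologicalSpace X] [CompactSpace X]
  {V : Type*} [NormedAddCommGroup V] [NormedSpace ℂ V]

/-- A continuous curve of continuous functions which is pointwise entire is entire. -/
lemma differentiable_of_forall_differentiable_eval [CompleteSpace V] {f : ℂ → C(X, V)}
    (hf : Continuous f) (hd : ∀ x, Differentiable ℂ fun k => f k x) : Differentiable ℂ f := by
  intro k₀
  have hcirc : CircleIntegrable f k₀ (1 : NNReal) :=
    hf.continuousOn.circleIntegrable (by simp)
  have hps := hasFPowerSeriesOn_cauchy_integral hcirc one_pos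
  refine (hps.differentiableOn.differentiableAt
    (Metric.eball_mem_nhds _ (by simp))).congr_of_eventuallyEq ?_
  filter_upwards [Metric.ball_mem_nhds k₀ one_pos] with k hk
  ext x
  have h1 := (hd x).differentiableOn.circleIntegral_sub_inv_smul (c := k₀) (R := 1) hk
  have hci : CircleIntegrable (fun z => (z - k)⁻¹ • f z) k₀ (1 : NNReal) := by
    have hinv : ContinuousOn (fun z : ℂ => (z - k)⁻¹) (Metric.sphere k₀ (1 : NNReal)) := ?_
    · exact (hinv.smul hf.continuousOn).circleIntegrable (by simp)
    refine ContinuousOn.inv₀ (by fun_prop) fun z hz h => ?_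
    rw [sub_eq_zero.1 h] at hz
    rw [Metric.mem_ball] at hk
    rw [mem_sphere_iff_norm, ← dist_eq_norm] at hz
    simp only [NNReal.coe_one] at hz
    linarith
  have h2 := (ContinuousMap.evalCLM ℂ x : C(X, V) →L[ℂ] V).intervalIntegral_comp_comm hci.out
  have h3 : (∮ z in C(k₀, (1 : NNReal)), (z - k)⁻¹ • f z) x =
      ∮ z in C(k₀, (1 : NNReal)), (z - k)⁻¹ • (f z x) := h2.symm
  rw [ContinuousMap.smul_apply, h3]
  simp only [NNReal.coe_one]
  rw [h1, inv_smul_smul₀]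
  simp [Real.pi_ne_zero]

lemma deriv_continuousMap_apply {f : ℂ → C(X, V)} (hf : Differentiable ℂ f) (k : ℂ) (x : X) :
    (deriv f k) x = deriv (fun k => f k x) k :=
  ((ContinuousMap.evalCLM ℂ x : C(X, V) →L[ℂ] V).hasFDerivAt.comp_hasDerivAt k
    (hf k).hasDerivAt).deriv.symm

end Curve

section Gram
variable {E : Type*} [NormedAddCommGroup E] [InnerProductSpace ℂ E]

/-- The Gram determinant of two vectors. -/
def gramDet (x y : E) : ℝ := ‖x‖ ^ 2 * ‖y‖ ^ 2 - ‖⟪x, y⟫_ℂ‖ ^ 2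

lemma ofReal_gramDet (x y : E) :
    (gramDet x y : ℂ) = ⟪x, x⟫_ℂ * ⟪y, y⟫_ℂ - ⟪y, x⟫_ℂ * ⟪x, y⟫_ℂ := by
  have h : ⟪y, x⟫_ℂ * ⟪x, y⟫_ℂ = ((‖⟪x, y⟫_ℂ‖ ^ 2 : ℝ) : ℂ) := by
    rw [← inner_conj_symm y x, mul_comm, Complex.mul_conj, Complex.normSq_eq_norm_sq]
  rw [h, inner_self_eq_norm_sq_to_K, inner_self_eq_norm_sq_to_K, gramDet]
  push_cast
  rfl

lemma gramDet_pos {x y : E} (h : ∀ a b : ℂ, a • x + b • y = 0 → a = 0 ∧ b = 0) :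
    0 < gramDet x y := by
  have hx : x ≠ 0 := fun hx => one_ne_zero (h 1 0 (by simp [hx])).1
  have hy : y ≠ 0 := fun hy => one_ne_zero (h 0 1 (by simp [hy])).2
  have h1 := norm_inner_le_norm (𝕜 := ℂ) x y
  have h2 : ‖⟪x, y⟫_ℂ‖ ≠ ‖x‖ * ‖y‖ := by
    intro he
    obtain ⟨r, -, hr⟩ := (norm_inner_eq_norm_iff hx hy).1 he
    exact one_ne_zero (neg_eq_zero.1 (h r (-1) (by rw [hr]; simp)).2)
  have h3 := lt_of_le_of_ne h1 h2
  rw [gramDet, ← mul_pow, sub_pos]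
  exact pow_lt_pow_left₀ h3 (norm_nonneg _) two_ne_zero

lemma gramDet_sub_smul (x y : E) (k : ℂ) :
    gramDet x (x - k • y) = ‖k‖ ^ 2 * gramDet x y := by
  have h : ((gramDet x (x - k • y) : ℝ) : ℂ) = ((‖k‖ ^ 2 * gramDet x y : ℝ) : ℂ) := by
    rw [ofReal_mul, ofReal_gramDet, ofReal_gramDet, ← Complex.normSq_eq_norm_sq,
      ← Complex.mul_conj]
    simp only [inner_sub_left, inner_sub_right, inner_smul_left, inner_smul_right]
    ring
  exact_mod_cast h

lemma contDiff_gramDet {x y : ℂ → E} [CompleteSpace E] (hx : Differentiable ℂ x)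
    (hy : Differentiable ℂ y) : ContDiff ℝ 2 fun k => gramDet (x k) (y k) := by
  have hx' : ContDiff ℝ 2 x := hx.contDiff.restrict_scalars ℝ
  have hy' : ContDiff ℝ 2 y := hy.contDiff.restrict_scalars ℝ
  exact ((hx'.norm_sq ℂ).mul (hy'.norm_sq ℂ)).sub ((hx'.inner ℂ hy').norm_sq ℂ)

end Gram

lemma fundDomain_subset_closedBall : FΛ ⊆ Metric.closedBall (0 : ℂ) 2 := by
  rintro z ⟨s, t, hs0, hs1, ht0, ht1, rfl⟩
  have hω : ‖ω‖ = 1 := by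
    rw [ω, show (2 * Real.pi * I / 3 : ℂ) = ((2 * Real.pi / 3 : ℝ) : ℂ) * I by push_cast; ring,
      Complex.norm_exp_ofReal_mul_I]
  rw [mem_closedBall_zero_iff]
  refine (norm_add_le _ _).trans ?_
  rw [norm_mul, hω, Complex.norm_real, Complex.norm_real, Real.norm_of_nonneg hs0,
    Real.norm_of_nonneg ht0]
  linarith

/-- A compact disc containing the fundamental domain. -/
abbrev Disc : Type := Metric.closedBall (0 : ℂ) 2

instance : CompactSpace Disc := isCompact_iff_compactSpace.1 (isCompact_closedBall _ _)

/-- Lebesgue measure on the fundamental domain, as a measure on `Disc`. -/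
def cellMeasure : Measure Disc := Measure.comap Subtype.val (volume.restrict FΛ)

lemma map_cellMeasure : Measure.map Subtype.val cellMeasure = volume.restrict FΛ := by
  rw [cellMeasure, map_comap_subtype_coe measurableSet_closedBall,
    Measure.restrict_restrict measurableSet_closedBall,
    Set.inter_eq_right.2 fundDomain_subset_closedBall]

instance : IsFiniteMeasure (volume.restrict FΛ) :=
  isFiniteMeasure_restrict.2
    (((measure_mono fundDomain_subset_closedBall).trans_lt measure_closedBall_lt_top).ne)

instance : IsFiniteMeasure cellMeasure := by
  constructor
  have h := Measure.map_apply (μ := cellMeasure) measurable_subtype_coe MeasurableSet.univ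
  rw [Set.preimage_univ] at h
  rw [← h, map_cellMeasure]
  exact measure_lt_top _ _

lemma integral_cellMeasure {G : Type*} [NormedAddCommGroup G] [NormedSpace ℝ G] (f : ℂ → G) :
    ∫ x : Disc, f x ∂cellMeasure = ∫ z in FΛ, f z := by
  rw [cellMeasure, integral_subtype_comap measurableSet_closedBall,
    Measure.restrict_restrict measurableSet_closedBall,
    Set.inter_eq_right.2 fundDomain_subset_closedBall]

/-- The Euclidean plane `ℂ²`. -/
abbrev E₂ : Type := WithLp 2 (ℂ × ℂ)

/-- The embedding of continuous `ℂ²`-valued functions into `L²` of the fundamental domain. -/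
def toL2 : C(Disc, E₂) →L[ℂ] Lp E₂ 2 cellMeasure := ContinuousMap.toLp 2 cellMeasure ℂ

lemma inner_toL2 {F G : C(Disc, E₂)} {f g : ℂ → E₂} (hf : ∀ x : Disc, F x = f x)
    (hg : ∀ x : Disc, G x = g x) : ⟪toL2 F, toL2 G⟫_ℂ = ∫ z in FΛ, ⟪f z, g z⟫_ℂ := by
  rw [L2.inner_def, ← integral_cellMeasure]
  apply integral_congr_ae
  filter_upwards [ContinuousMap.coeFn_toLp (p := 2) (𝕜 := ℂ) cellMeasure F,
    ContinuousMap.coeFn_toLp (p := 2) (𝕜 := ℂ) cellMeasure G] with x h1 h2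
  rw [toL2, h1, h2, hf, hg]

lemma eq_zero_of_toL2_eq_zero {F : C(Disc, E₂)} {f : ℂ → E₂} (hf : ∀ x : Disc, F x = f x)
    (h : toL2 F = 0) {W : Set ℂ} (hW : IsOpen W) (hWs : W ⊆ FΛ) (hc : ContinuousOn f W) :
    ∀ z ∈ W, f z = 0 := by
  have h1 : ∀ᵐ x ∂cellMeasure, f (x : Disc) = 0 := by
    filter_upwards [ContinuousMap.coeFn_toLp (p := 2) (𝕜 := ℂ) cellMeasure F,
      Lp.coeFn_zero (E := E₂) (p := 2) (μ := cellMeasure)] with x h1 h2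
    rw [← hf, ← h1]
    change (toL2 F : Disc → E₂) x = 0
    rw [h, h2]; rfl
  rw [← (MeasurableEmbedding.subtype_coe measurableSet_closedBall).ae_map_iff
    (p := fun z : ℂ => f z = 0), map_cellMeasure] at h1
  have h2 : f =ᵐ[volume.restrict W] fun _ => 0 := ae_restrict_of_ae_restrict_of_subset hWs h1
  exact fun z hz => Measure.eqOn_open_of_ae_eq h2 hW hc continuousOn_const hz

attribute [local irreducible] theta

lemma sub_mem_lattice {x y : ℂ} (hx : x ∈ Λ) (hy : y ∈ Λ) : x - y ∈ Λ := by
  obtain ⟨m, n, rfl⟩ := hx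
  obtain ⟨m', n', rfl⟩ := hy
  exact ⟨m - m', n - n', by push_cast; ring⟩

lemma neg_mem_lattice {x : ℂ} (hx : x ∈ Λ) : -x ∈ Λ := by
  obtain ⟨m, n, rfl⟩ := hx
  exact ⟨-m, -n, by push_cast; ring⟩

lemma theta_eq_zero_of_mem_lattice {ζ : ℂ} (h : ζ ∈ Λ) : theta ζ = 0 := by
  obtain ⟨m, n, rfl⟩ := h
  have h1 : ∀ n : ℤ, theta n = 0 := by
    intro n
    induction n with
    | zero => simpa using theta_zero
    | succ n ih =>
      rw [show (((n + 1 : ℤ) : ℤ) : ℂ) = ((n : ℤ) : ℂ) + 1 by push_cast; ring, theta_add_one, ih,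
        neg_zero]
    | pred n ih =>
      rw [show ((-n - 1 : ℤ) : ℂ) = ((-n : ℤ) : ℂ) - 1 by push_cast; ring, theta_sub_one, ih,
        neg_zero]
  rw [add_comm]
  exact theta_add_int_mul_omega_eq_zero m (h1 n)

lemma theta_eq_zero_iff {ζ : ℂ} : theta ζ = 0 ↔ ζ ∈ Λ :=
  ⟨mem_lattice_of_theta_eq_zero, theta_eq_zero_of_mem_lattice⟩

lemma continuous_theta : Continuous theta := differentiable_theta.continuous

lemma countable_lattice : Λ.Countable := by
  have : Λ = Set.range fun p : ℤ × ℤ => (p.1 * ω + p.2 : ℂ) := by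
    ext z
    simp only [Λ, Set.mem_ofPred_eq, Set.mem_range, Prod.exists]
    exact ⟨fun ⟨m, n, h⟩ => ⟨m, n, h.symm⟩, fun ⟨m, n, h⟩ => ⟨m, n, h.symm⟩⟩
  rw [this]
  exact Set.countable_range _

lemma dense_theta_ne_zero (c : ℂ) : Dense {z : ℂ | theta (z + c) ≠ 0} := by
  have h : {z : ℂ | theta (z + c) ≠ 0} = ((fun z => z + c) ⁻¹' Λ)ᶜ := by
    ext z; simp [theta_eq_zero_iff]
  rw [h]
  exact (countable_lattice.preimage (add_left_injective c)).dense_compl ℝ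

lemma sqrt_three_ne_zero : (Real.sqrt 3 : ℂ) ≠ 0 := by simp

lemma lattice_im {m n : ℤ} : ((m : ℂ) * ω + n).im = m * (Real.sqrt 3 / 2) := by
  have : (m : ℂ) = ((m : ℝ) : ℂ) := by push_cast; rfl
  rw [add_im, this, im_ofReal_mul, omega_im]; simp

lemma half_notMem_lattice : (1 / 2 : ℂ) ∉ Λ := by
  rintro ⟨m, n, h⟩
  have h1 := congrArg Complex.im h
  rw [lattice_im] at h1
  have hs : (0 : ℝ) < Real.sqrt 3 / 2 := by positivity
  have h2 : (m : ℝ) = 0 := by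
    have : (m : ℝ) * (Real.sqrt 3 / 2) = 0 := by rw [← h1]; simp
    exact (mul_eq_zero.1 this).resolve_right hs.ne'
  have h3 : m = 0 := by exact_mod_cast h2
  rw [h3] at h
  have h4 : (1 : ℂ) = ((2 * n : ℤ) : ℂ) := by
    push_cast at h ⊢
    linear_combination 2 * h
  have h5 : (1 : ℤ) = 2 * n := by exact_mod_cast h4
  omega

lemma two_zS_notMem_lattice : 2 * zS ∉ Λ := by
  rintro ⟨m, n, h⟩
  have h1 := congrArg Complex.im h
  rw [lattice_im] at h1
  have h3 : (0 : ℝ) < Real.sqrt 3 := by positivity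
  have h4 : Real.sqrt 3 * Real.sqrt 3 = 3 := Real.mul_self_sqrt (by norm_num)
  have h2 : (2 * zS).im = 2 / Real.sqrt 3 := by
    rw [zS, show (2 * (I / Real.sqrt 3) : ℂ) = ((2 / Real.sqrt 3 : ℝ) : ℂ) * I by
      push_cast; ring]
    rw [im_ofReal_mul, I_im, mul_one]
  rw [h2, div_eq_iff h3.ne'] at h1
  have h5 : (4 : ℝ) = m * 3 := by
    linear_combination 2 * h1 + m * h4
  have h6 : (4 : ℤ) = m * 3 := by exact_mod_cast h5
  omega

lemma theta_two_zS_ne_zero : theta (2 * zS) ≠ 0 :=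
  fun h => two_zS_notMem_lattice (theta_eq_zero_iff.1 h)

lemma theta_neg_two_zS_ne_zero : theta (-(2 * zS)) ≠ 0 := fun h =>
  two_zS_notMem_lattice (by simpa using neg_mem_lattice (theta_eq_zero_iff.1 h))

lemma zmap_dual (x : ℂ) : zmap (4 * Real.pi * I / Real.sqrt 3 * x) = x := by
  have := sqrt_three_ne_zero
  rw [zmap]
  field_simp

lemma zmap_add (k p : ℂ) : zmap (k + p) = zmap k + zmap p := by
  simp only [zmap]; ring

lemma eq_dual_zmap (k : ℂ) : k = 4 * Real.pi * I / Real.sqrt 3 * zmap k := by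
  have := sqrt_three_ne_zero
  rw [zmap]
  field_simp

lemma mem_dual_iff {k : ℂ} : k ∈ Λdual ↔ zmap k ∈ Λ := by
  constructor
  · rintro ⟨m, n, rfl⟩
    exact ⟨m, n, zmap_dual _⟩
  · rintro ⟨m, n, h⟩
    exact ⟨m, n, by rw [← h]; exact eq_dual_zmap k⟩

lemma theta_neg_zmap_ne_zero {k : ℂ} (hk : k ∉ Λdual) : theta (-zmap k) ≠ 0 :=
  fun h => hk (mem_dual_iff.2 (by simpa using neg_mem_lattice (theta_eq_zero_iff.1 h)))

lemma differentiable_zmap : Differentiable ℂ zmap := by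
  unfold zmap; fun_prop

lemma continuous_zmap : Continuous zmap := differentiable_zmap.continuous

lemma zmap_zero : zmap 0 = 0 := by simp [zmap]

/-- The numerator of `Fk k (z + c)`. -/
def blochFactor (c k z : ℂ) : ℂ :=
  Complex.exp (I / 2 * ((z + c) - (starRingEnd ℂ) (z + c)) * k) * theta (z + c - zmap k)

lemma continuous_blochFactor (c : ℂ) : Continuous fun p : ℂ × ℂ => blochFactor c p.1 p.2 := by
  have h1 := continuous_theta
  have h2 := continuous_zmap
  have h3 := Complex.continuous_conj
  unfold blochFactor
  fun_prop

lemma differentiable_blochFactor (c z : ℂ) : Differentiable ℂ fun k => blochFactor c k z := by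
  have h1 := differentiable_theta
  have h2 := differentiable_zmap
  unfold blochFactor
  fun_prop

lemma blochFactor_zero (c z : ℂ) : blochFactor c 0 z = theta (z + c) := by
  simp [blochFactor, zmap_zero]

lemma blochFactor_eq (c k z : ℂ) : blochFactor c k z =
    Complex.exp (-(z.im : ℂ) * k) *
      (Complex.exp (-(c.im : ℂ) * k) * theta (z + c - zmap k)) := by
  rw [blochFactor, ← mul_assoc, ← Complex.exp_add, sub_conj]
  congr 2
  simp only [add_im]
  push_cast
  linear_combination (z.im + c.im) * k * I_mul_I

lemma hasDerivAt_blochFactor_zero (c z : ℂ) : HasDerivAt (fun k => blochFactor c k z)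
    (-(z.im + c.im) * theta (z + c) - zmap 1 * deriv theta (z + c)) 0 := by
  have hz : HasDerivAt (fun k => z + c - zmap k) (-(zmap 1)) 0 := by
    have : zmap = fun k => zmap 1 * k := by ext k; simp [zmap]; ring
    refine HasDerivAt.const_sub (z + c) ?_
    conv => enter [1]; rw [this]
    simpa using (hasDerivAt_id (0 : ℂ)).const_mul (zmap 1)
  have h1 : HasDerivAt (fun k => theta (z + c - zmap k)) (deriv theta (z + c) * -(zmap 1)) 0 := by
    refine HasDerivAt.comp (h₂ := theta) (h := fun k => z + c - zmap k) 0 ?_ hz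
    rw [zmap_zero, sub_zero]
    exact (differentiable_theta _).hasDerivAt
  have h3 : HasDerivAt (fun k : ℂ => Complex.exp (-(z.im + c.im : ℂ) * k))
      (-(z.im + c.im : ℂ)) 0 := by
    simpa using ((hasDerivAt_id (0 : ℂ)).const_mul (-(z.im + c.im : ℂ))).cexp
  have h4 : (fun k => blochFactor c k z) =
      fun k => Complex.exp (-(z.im + c.im : ℂ) * k) * theta (z + c - zmap k) := by
    ext k
    rw [blochFactor_eq, ← mul_assoc, ← Complex.exp_add]
    ring_nf
  rw [h4]
  refine (h3.mul h1).congr_deriv ?_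
  rw [zmap_zero, mul_zero, Complex.exp_zero, sub_zero]
  ring

/-- The quotient of `u₀` by the translated theta function, extended across the lattice. -/
lemma exists_theta_quotient (c : ℂ) {v : ℂ → ℂ → ℂ × ℂ} {u₀ : ℂ → ℂ × ℂ} (hu₀ : Continuous u₀)
    (hv : ∀ k ∉ Λdual, Continuous (v k))
    (hF : ∀ k ∉ Λdual, ∀ z : ℂ, z + c ∉ Λ → v k z = Fk k (z + c) • u₀ z) :
    ∃ w : ℂ → ℂ × ℂ, Continuous w ∧ (∀ z, theta (z + c) • w z = u₀ z) ∧
      ∀ k ∉ Λdual, ∀ z, v k z = blochFactor c k z • w z := by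
  classical
  have hθ := continuous_theta
  obtain ⟨k₁, hzk₁⟩ : ∃ k₁, zmap k₁ = 1 / 2 := ⟨_, zmap_dual _⟩
  have hk₁' : k₁ ∉ Λdual := fun h => by
    have := mem_dual_iff.1 h
    rw [hzk₁] at this
    exact half_notMem_lattice this
  have hbc : ∀ k, Continuous fun z => blochFactor c k z := fun k =>
    Continuous.comp (g := fun p : ℂ × ℂ => blochFactor c p.1 p.2) (f := fun z => (k, z))
      (continuous_blochFactor c) (by fun_prop)
  have hFb : ∀ k ∉ Λdual, ∀ z, theta (z + c) ≠ 0 →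
      v k z = blochFactor c k z • (theta (z + c))⁻¹ • u₀ z := by
    intro k hk z hz
    rw [hF k hk z (fun h => hz (theta_eq_zero_iff.2 h)), Fk, smul_smul, blochFactor, div_eq_mul_inv]
  obtain ⟨w, hweq, hwne⟩ : ∃ w : ℂ → ℂ × ℂ,
      (∀ z, theta (z + c) = 0 → w z = (blochFactor c k₁ z)⁻¹ • v k₁ z) ∧
      ∀ z, theta (z + c) ≠ 0 → w z = (theta (z + c))⁻¹ • u₀ z :=
    ⟨fun z => if theta (z + c) = 0 then (blochFactor c k₁ z)⁻¹ • v k₁ z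
      else (theta (z + c))⁻¹ • u₀ z, fun z hz => if_pos hz, fun z hz => if_neg hz⟩
  have hwc : Continuous w := by
    rw [continuous_iff_continuousAt]
    intro z
    by_cases hz : theta (z + c) = 0
    · have hb : blochFactor c k₁ z ≠ 0 := by
        rw [blochFactor, hzk₁]
        refine mul_ne_zero (Complex.exp_ne_zero _) fun h => half_notMem_lattice ?_
        have := sub_mem_lattice (theta_eq_zero_iff.1 hz) (theta_eq_zero_iff.1 h)
        rwa [sub_sub_cancel] at this
      have hcont : ContinuousAt (fun z => (blochFactor c k₁ z)⁻¹ • v k₁ z) z :=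
        ((hbc k₁).continuousAt.inv₀ hb).smul (hv k₁ hk₁').continuousAt
      refine hcont.congr ?_
      filter_upwards [(hbc k₁).continuousAt.eventually_ne hb] with y hy
      by_cases hy0 : theta (y + c) = 0
      · exact (hweq y hy0).symm
      · rw [hwne y hy0, hFb k₁ hk₁' y hy0, inv_smul_smul₀ hy]
    · have hc : Continuous fun z => theta (z + c) := by fun_prop
      have hcont : ContinuousAt (fun z => (theta (z + c))⁻¹ • u₀ z) z :=
        (hc.continuousAt.inv₀ hz).smul hu₀.continuousAt
      refine hcont.congr ?_
      filter_upwards [hc.continuousAt.eventually_ne hz] with y hy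
      exact (hwne y hy).symm
  refine ⟨w, hwc, fun z => ?_, fun k hk z => ?_⟩
  · have h1 : Continuous fun z => theta (z + c) • w z :=
      (hθ.comp (continuous_id.add continuous_const)).smul hwc
    exact congrFun (h1.ext_on (dense_theta_ne_zero c) hu₀ fun y hy => by
      change theta (y + c) • w y = u₀ y
      rw [hwne y hy, smul_inv_smul₀ hy]) z
  · exact congrFun ((hv k hk).ext_on (dense_theta_ne_zero c) ((hbc k).smul hwc) fun y hy => by
      change v k y = blochFactor c k y • w y
      rw [hFb k hk y hy, hwne y hy]) z

/-- The open set inside the fundamental domain where a quasi-periodic function is nonzero. -/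
lemma exists_open_subset_fundDomain {u₀ : ℂ → ℂ × ℂ} (hu₀ : Continuous u₀) (hne : u₀ ≠ 0)
    (hper : ∀ γ ∈ Λ, ∀ z, u₀ z = 0 → u₀ (z + γ) = 0) :
    ∃ W : Set ℂ, IsOpen W ∧ W.Nonempty ∧ W ⊆ FΛ ∧ ∀ z ∈ W, u₀ z ≠ 0 := by
  have h3 : (0 : ℝ) < Real.sqrt 3 := by positivity
  set tc : ℂ → ℝ := fun z => z.im / (Real.sqrt 3 / 2) with htc
  set sc : ℂ → ℝ := fun z => z.re + tc z / 2 with hsc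
  have htcc : Continuous tc := by fun_prop
  have hscc : Continuous sc := by fun_prop
  have hcoord : ∀ z : ℂ, z = (sc z : ℂ) + (tc z : ℂ) * ω := by
    intro z
    apply Complex.ext
    · rw [add_re, re_ofReal_mul, omega_re, ofReal_re]; simp only [hsc]; ring
    · rw [add_im, im_ofReal_mul, omega_im, ofReal_im]; simp only [htc]; field_simp; ring
  have htcω : ∀ s t : ℝ, tc ((s : ℂ) + t * ω) = t := by
    intro s t
    simp only [htc, add_im, im_ofReal_mul, omega_im, ofReal_im]; field_simp; ring
  have hscω : ∀ s t : ℝ, sc ((s : ℂ) + t * ω) = s := by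
    intro s t
    simp only [hsc, htcω, add_re, re_ofReal_mul, omega_re, ofReal_re]; ring
  obtain ⟨z₀, hz₀⟩ : ∃ z, u₀ z ≠ 0 := by
    by_contra h
    push Not at h
    exact hne (funext h)
  set s := Int.fract (sc z₀) with hs
  set t := Int.fract (tc z₀) with ht
  have hz₁ : u₀ ((s : ℂ) + t * ω) ≠ 0 := by
    intro h
    have := hper (⌊tc z₀⌋ * ω + ⌊sc z₀⌋) ⟨_, _, rfl⟩ _ h
    apply hz₀
    rw [hcoord z₀, ← this]
    congr 1
    have e1 : (sc z₀ : ℂ) = (⌊sc z₀⌋ : ℂ) + (s : ℂ) := by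
      rw [hs]; exact_mod_cast (Int.floor_add_fract (sc z₀)).symm
    have e2 : (tc z₀ : ℂ) = (⌊tc z₀⌋ : ℂ) + (t : ℂ) := by
      rw [ht]; exact_mod_cast (Int.floor_add_fract (tc z₀)).symm
    linear_combination e1 + ω * e2
  have hcurve : Filter.Tendsto (fun ε : ℝ => u₀ (((s + ε : ℝ) : ℂ) + ((t + ε : ℝ) : ℂ) * ω))
      (nhdsWithin 0 (Set.Ioi 0)) (nhds (u₀ ((s : ℂ) + t * ω))) := by
    have hc : Continuous fun ε : ℝ => u₀ (((s + ε : ℝ) : ℂ) + ((t + ε : ℝ) : ℂ) * ω) := by fun_prop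
    have := hc.tendsto 0
    simp only [add_zero] at this
    exact this.mono_left nhdsWithin_le_nhds
  have hs1 : 0 < 1 - s := sub_pos.2 (Int.fract_lt_one _)
  have ht1 : 0 < 1 - t := sub_pos.2 (Int.fract_lt_one _)
  have hev : ∀ᶠ ε : ℝ in nhdsWithin 0 (Set.Ioi 0), ε < 1 - s ∧ ε < 1 - t :=
    Filter.Eventually.filter_mono nhdsWithin_le_nhds
      ((eventually_lt_nhds hs1).and (eventually_lt_nhds ht1))
  obtain ⟨ε, hε, ⟨hεs, hεt⟩, hε0⟩ := ((hcurve.eventually_ne hz₁).and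
    (hev.and self_mem_nhdsWithin)).exists
  have hε0' : 0 < ε := hε0
  have hs0 : 0 ≤ s := Int.fract_nonneg _
  have ht0 : 0 ≤ t := Int.fract_nonneg _
  refine ⟨{z | u₀ z ≠ 0} ∩ (sc ⁻¹' Set.Ioo 0 1 ∩ tc ⁻¹' Set.Ioo 0 1), ?_, ?_, ?_, fun z hz => hz.1⟩
  · exact (isOpen_ne_fun hu₀ continuous_const).inter
      ((isOpen_Ioo.preimage hscc).inter (isOpen_Ioo.preimage htcc))
  · refine ⟨_, hε, ?_, ?_⟩
    · rw [Set.mem_preimage, hscω]; constructor <;> linarith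
    · rw [Set.mem_preimage, htcω]; constructor <;> linarith
  · rintro z ⟨-, h1, h2⟩
    exact ⟨sc z, tc z, h1.1.le, h1.2, h2.1.le, h2.2, hcoord z⟩

/-- The curve `k ↦ blochFactor c k • w` of continuous functions. -/
def blochCurve (c : ℂ) (w : C(ℂ, ℂ × ℂ)) : C(ℂ, C(Disc, E₂)) :=
  ContinuousMap.curry ⟨fun p : ℂ × Disc => WithLp.toLp 2 (blochFactor c p.1 p.2 • w p.2), by
    have h1 : Continuous fun p : ℂ × Disc => blochFactor c p.1 p.2 :=
      Continuous.comp (g := fun p : ℂ × ℂ => blochFactor c p.1 p.2)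
        (f := fun p : ℂ × Disc => (p.1, (p.2 : ℂ))) (continuous_blochFactor c) (by fun_prop)
    have h2 : Continuous fun p : ℂ × Disc => w p.2 := by fun_prop
    exact (WithLp.prod_continuous_toLp 2 ℂ ℂ).comp (h1.smul h2)⟩

lemma blochCurve_apply (c : ℂ) (w : C(ℂ, ℂ × ℂ)) (k : ℂ) (x : Disc) :
    blochCurve c w k x = WithLp.toLp 2 (blochFactor c k x • w x) := rfl

lemma differentiable_blochCurve (c : ℂ) (w : C(ℂ, ℂ × ℂ)) :
    Differentiable ℂ (blochCurve c w) := by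
  refine differentiable_of_forall_differentiable_eval (map_continuous _) fun x => ?_
  simp only [blochCurve_apply, WithLp.toLp_smul]
  exact (differentiable_blochFactor c x).smul_const _

lemma continuous_blochFactor_right (c k : ℂ) : Continuous fun z => blochFactor c k z :=
  Continuous.comp (g := fun p : ℂ × ℂ => blochFactor c p.1 p.2) (f := fun z => (k, z))
    (continuous_blochFactor c) (by fun_prop)

lemma eq_zero_of_eqOn_zero {P : ℂ → ℂ} (hP : Differentiable ℂ P) {W : Set ℂ} (hW : IsOpen W)
    (hne : W.Nonempty) (h : ∀ z ∈ W, P z = 0) (z : ℂ) : P z = 0 := by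
  obtain ⟨z₀, hz₀⟩ := hne
  have h1 : AnalyticOnNhd ℂ P Set.univ := fun z _ => hP.analyticAt z
  have h2 : P =ᶠ[nhds z₀] fun _ => 0 := by
    filter_upwards [hW.mem_nhds hz₀] with y hy using h y hy
  exact h1.eqOn_of_preconnected_of_eventuallyEq (fun z _ => analyticAt_const)
    isPreconnected_univ (Set.mem_univ z₀) h2 (Set.mem_univ z)

section Independence
variable {u₀ : ℂ → ℂ × ℂ} {w₀ w₁ : C(ℂ, ℂ × ℂ)} {W : Set ℂ}

lemma coeff_eq_zero_of_smul_add_smul_eq_zero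
    (h₀ : ∀ z, theta (z + zS) • w₀ z = u₀ z) (h₁ : ∀ z, theta (z + -zS) • w₁ z = u₀ z)
    {z x y : ℂ} (hz : u₀ z ≠ 0) (h : x • w₀ z + y • w₁ z = 0) :
    x * theta (z + -zS) + y * theta (z + zS) = 0 := by
  have h2 : (x * theta (z + -zS) + y * theta (z + zS)) • u₀ z = 0 := by
    have h3 : (x * theta (z + -zS)) • u₀ z = (theta (z + zS) * theta (z + -zS)) • x • w₀ z := by
      rw [← h₀, smul_smul, smul_smul]; congr 1; ring
    have h4 : (y * theta (z + zS)) • u₀ z = (theta (z + zS) * theta (z + -zS)) • y • w₁ z := by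
      rw [← h₁, smul_smul, smul_smul]; congr 1; ring
    rw [add_smul, h3, h4, ← smul_add, h, smul_zero]
  exact (smul_eq_zero.1 h2).resolve_right hz

lemma blochCurve_independent
    (h₀ : ∀ z, theta (z + zS) • w₀ z = u₀ z) (h₁ : ∀ z, theta (z + -zS) • w₁ z = u₀ z)
    (hW : IsOpen W) (hWne : W.Nonempty) (hWs : W ⊆ FΛ) (hu : ∀ z ∈ W, u₀ z ≠ 0) {k : ℂ}
    (hk : k ∉ Λdual) (a b : ℂ)
    (h : a • toL2 (blochCurve zS w₀ k) + b • toL2 (blochCurve (-zS) w₁ k) = 0) :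
    a = 0 ∧ b = 0 := by
  rw [← map_smul toL2, ← map_smul toL2, ← map_add toL2] at h
  have hf := eq_zero_of_toL2_eq_zero (f := fun z => WithLp.toLp 2
    ((a * blochFactor zS k z) • w₀ z + (b * blochFactor (-zS) k z) • w₁ z))
    (fun x => by
      rw [ContinuousMap.add_apply, ContinuousMap.smul_apply, ContinuousMap.smul_apply,
        blochCurve_apply, blochCurve_apply, ← WithLp.toLp_smul, ← WithLp.toLp_smul,
        ← WithLp.toLp_add, smul_smul, smul_smul]) h hW hWs (by
      refine Continuous.continuousOn ((WithLp.prod_continuous_toLp 2 ℂ ℂ).comp ?_)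
      have e1 := continuous_blochFactor_right zS k
      have e2 := continuous_blochFactor_right (-zS) k
      fun_prop)
  have hd := differentiable_theta
  set P : ℂ → ℂ := fun z =>
    a * Complex.exp (-(zS.im : ℂ) * k) * theta (z + zS - zmap k) * theta (z + -zS) +
    b * Complex.exp (-((-zS).im : ℂ) * k) * theta (z + -zS - zmap k) * theta (z + zS) with hP
  have hPd : Differentiable ℂ P := by fun_prop
  have hP0 : ∀ z, P z = 0 := by
    refine eq_zero_of_eqOn_zero hPd hW hWne fun z hz => ?_
    have h2 := coeff_eq_zero_of_smul_add_smul_eq_zero h₀ h₁ (hu z hz)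
      ((WithLp.toLp_eq_zero 2).1 (hf z hz))
    rw [blochFactor_eq, blochFactor_eq] at h2
    refine (mul_eq_zero.1 (?_ : Complex.exp (-(z.im : ℂ) * k) * P z = 0)).resolve_left
      (Complex.exp_ne_zero _)
    rw [← h2, hP]
    ring
  have ha := hP0 (-zS)
  have hb := hP0 zS
  have e1 : -zS + -zS = -(2 * zS) := by ring
  have e2 : zS + zS = 2 * zS := by ring
  simp only [hP, neg_add_cancel, add_neg_cancel, theta_zero, mul_zero, add_zero, zero_add, e1, e2,
    zero_sub] at ha hb
  simp only [mul_eq_zero, Complex.exp_ne_zero, theta_neg_zmap_ne_zero hk, theta_two_zS_ne_zero,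
    theta_neg_two_zS_ne_zero, or_false] at ha hb
  exact ⟨ha, hb⟩

/-- The divided difference of the two curves. -/
def blochSlope (w₀ w₁ : C(ℂ, ℂ × ℂ)) : ℂ → C(Disc, E₂) :=
  dslope (fun k => blochCurve zS w₀ k - blochCurve (-zS) w₁ k) 0

lemma differentiable_blochSlope (w₀ w₁ : C(ℂ, ℂ × ℂ)) : Differentiable ℂ (blochSlope w₀ w₁) := by
  have h : Differentiable ℂ fun k => blochCurve zS w₀ k - blochCurve (-zS) w₁ k :=
    (differentiable_blochCurve _ _).sub (differentiable_blochCurve _ _)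
  exact differentiableOn_univ.1
    ((Complex.differentiableOn_dslope Filter.univ_mem).2 h.differentiableOn)

lemma blochCurve_eq_sub
    (h₀ : ∀ z, theta (z + zS) • w₀ z = u₀ z) (h₁ : ∀ z, theta (z + -zS) • w₁ z = u₀ z) (k : ℂ) :
    blochCurve (-zS) w₁ k = blochCurve zS w₀ k - k • blochSlope w₀ w₁ k := by
  have h := sub_smul_dslope (fun k => blochCurve zS w₀ k - blochCurve (-zS) w₁ k) 0 k
  have h2 : blochCurve zS w₀ 0 - blochCurve (-zS) w₁ 0 = 0 := by
    ext1 x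
    rw [ContinuousMap.sub_apply, blochCurve_apply, blochCurve_apply, blochFactor_zero,
      blochFactor_zero, h₀, h₁, sub_self, ContinuousMap.zero_apply]
  simp only [h2, sub_zero] at h
  rw [blochSlope, h, sub_sub_cancel]

lemma blochSlope_independent
    (h₀ : ∀ z, theta (z + zS) • w₀ z = u₀ z) (h₁ : ∀ z, theta (z + -zS) • w₁ z = u₀ z)
    (hW : IsOpen W) (hWne : W.Nonempty) (hWs : W ⊆ FΛ) (hu : ∀ z ∈ W, u₀ z ≠ 0) (a b : ℂ)
    (h : a • toL2 (blochCurve zS w₀ 0) + b • toL2 (blochSlope w₀ w₁ 0) = 0) :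
    a = 0 ∧ b = 0 := by
  have hd := differentiable_theta
  have hd' : Differentiable ℂ (deriv theta) := hd.deriv
  have hc' := hd'.continuous
  have hc := continuous_theta
  have hderiv : ∀ x : Disc, blochSlope w₀ w₁ 0 x = WithLp.toLp 2
      ((-((x : ℂ).im + zS.im) * theta (x + zS) - zmap 1 * deriv theta (x + zS)) • w₀ x -
      (-((x : ℂ).im + (-zS).im) * theta (x + -zS) - zmap 1 * deriv theta (x + -zS)) • w₁ x) := by
    intro x
    have h : Differentiable ℂ fun k => blochCurve zS w₀ k - blochCurve (-zS) w₁ k :=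
      (differentiable_blochCurve _ _).sub (differentiable_blochCurve _ _)
    rw [blochSlope, dslope_same, deriv_continuousMap_apply h]
    simp only [ContinuousMap.sub_apply, blochCurve_apply, WithLp.toLp_smul, WithLp.toLp_sub]
    exact (((hasDerivAt_blochFactor_zero zS x).smul_const _).sub
      ((hasDerivAt_blochFactor_zero (-zS) x).smul_const _)).deriv
  rw [← map_smul toL2, ← map_smul toL2, ← map_add toL2] at h
  have hf := eq_zero_of_toL2_eq_zero (f := fun z => WithLp.toLp 2
    ((a * theta (z + zS) +
      b * (-(z.im + zS.im) * theta (z + zS) - zmap 1 * deriv theta (z + zS))) • w₀ z +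
    (-b * (-(z.im + (-zS).im) * theta (z + -zS) - zmap 1 * deriv theta (z + -zS))) • w₁ z))
    (fun x => by
      rw [ContinuousMap.add_apply, ContinuousMap.smul_apply, ContinuousMap.smul_apply,
        blochCurve_apply, hderiv, ← WithLp.toLp_smul, ← WithLp.toLp_smul,
        ← WithLp.toLp_add, blochFactor_zero]
      congr 1
      module) h hW hWs (by
      refine Continuous.continuousOn ((WithLp.prod_continuous_toLp 2 ℂ ℂ).comp ?_)
      fun_prop)
  set P : ℂ → ℂ := fun z =>
    (a - 2 * b * zS.im) * theta (z + zS) * theta (z + -zS) -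
    b * zmap 1 * (deriv theta (z + zS) * theta (z + -zS) - deriv theta (z + -zS) * theta (z + zS))
    with hP
  have hPd : Differentiable ℂ P := by fun_prop
  have hP0 : ∀ z, P z = 0 := by
    refine eq_zero_of_eqOn_zero hPd hW hWne fun z hz => ?_
    rw [← coeff_eq_zero_of_smul_add_smul_eq_zero h₀ h₁ (hu z hz)
      ((WithLp.toLp_eq_zero 2).1 (hf z hz)), hP]
    simp only [neg_im, ofReal_neg]
    ring
  have hκ : zmap 1 ≠ 0 := by
    intro h0
    have := eq_dual_zmap 1
    rw [h0, mul_zero] at this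
    exact one_ne_zero this
  have e2 : zS + zS = 2 * zS := by ring
  have hb := hP0 zS
  simp only [hP, add_neg_cancel, theta_zero, mul_zero, zero_sub, e2, mul_neg, neg_neg,
    mul_eq_zero, hκ, deriv_theta_zero_ne_zero, theta_two_zS_ne_zero, or_false] at hb
  refine ⟨?_, hb⟩
  obtain ⟨z, hz⟩ := hWne
  have hfz := (WithLp.toLp_eq_zero 2).1 (hf z hz)
  simp only [hb, zero_mul, neg_zero, add_zero, zero_smul] at hfz
  rw [mul_smul, h₀] at hfz
  exact (smul_eq_zero.1 hfz).resolve_right (hu z hz)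

end Independence

/-- The Gram determinant of the two Bloch functions. -/
def blochGram (w₀ w₁ : C(ℂ, ℂ × ℂ)) (k : ℂ) : ℝ :=
  gramDet (toL2 (blochCurve zS w₀ k)) (toL2 (blochCurve (-zS) w₁ k))

lemma inner_blochCurve (c c' : ℂ) (w w' : C(ℂ, ℂ × ℂ)) (k : ℂ) :
    ⟪toL2 (blochCurve c w k), toL2 (blochCurve c' w' k)⟫_ℂ = ∫ z in FΛ,
      ⟪(WithLp.toLp 2 (blochFactor c k z • w z) : E₂),
        WithLp.toLp 2 (blochFactor c' k z • w' z)⟫_ℂ :=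
  inner_toL2 (f := fun z => (WithLp.toLp 2 (blochFactor c k z • w z) : E₂))
    (g := fun z => (WithLp.toLp 2 (blochFactor c' k z • w' z) : E₂))
    (fun _ => rfl) fun _ => rfl

lemma inner_blochCurve_add {c c' k p n n' : ℂ} {X : ℂ → ℂ} (hX : ∀ z, ‖X z‖ = 1)
    (w w' : C(ℂ, ℂ × ℂ)) (h : ∀ z, blochFactor c (k + p) z = n * X z * blochFactor c k z)
    (h' : ∀ z, blochFactor c' (k + p) z = n' * X z * blochFactor c' k z) :
    ⟪toL2 (blochCurve c w (k + p)), toL2 (blochCurve c' w' (k + p))⟫_ℂ =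
      (starRingEnd ℂ) n * n' * ⟪toL2 (blochCurve c w k), toL2 (blochCurve c' w' k)⟫_ℂ := by
  rw [inner_blochCurve, inner_blochCurve, ← integral_const_mul]
  congr 1
  ext z
  have hXz : (starRingEnd ℂ) (X z) * X z = 1 := by
    rw [mul_comm, Complex.mul_conj, Complex.normSq_eq_norm_sq, hX]; simp
  rw [h, h', mul_smul, mul_smul (n' * X z), WithLp.toLp_smul 2 (n * X z),
    WithLp.toLp_smul 2 (n' * X z), inner_smul_left, inner_smul_right, map_mul]
  linear_combination (starRingEnd ℂ) n * n' * ⟪(WithLp.toLp 2 (blochFactor c k z • w z) : E₂),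
        WithLp.toLp 2 (blochFactor c' k z • w' z)⟫_ℂ * hXz

lemma blochGram_add {k p n n' : ℂ} {X : ℂ → ℂ} (hX : ∀ z, ‖X z‖ = 1) {M : ℝ} (hn : ‖n‖ = M)
    (hn' : ‖n'‖ = M) (w₀ w₁ : C(ℂ, ℂ × ℂ))
    (h : ∀ z, blochFactor zS (k + p) z = n * X z * blochFactor zS k z)
    (h' : ∀ z, blochFactor (-zS) (k + p) z = n' * X z * blochFactor (-zS) k z) :
    blochGram w₀ w₁ (k + p) = M ^ 4 * blochGram w₀ w₁ k := by
  have e : ∀ x : ℂ, ‖x‖ = M → (starRingEnd ℂ) x * x = (M : ℂ) ^ 2 := by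
    intro x hx
    rw [mul_comm, Complex.mul_conj, Complex.normSq_eq_norm_sq, hx]; simp
  have e1 := e n hn
  have e2 := e n' hn'
  have key : ((blochGram w₀ w₁ (k + p) : ℝ) : ℂ) = ((M ^ 4 * blochGram w₀ w₁ k : ℝ) : ℂ) := by
    rw [ofReal_mul, blochGram, blochGram, ofReal_gramDet, ofReal_gramDet,
      inner_blochCurve_add hX w₀ w₀ h h, inner_blochCurve_add hX w₁ w₁ h' h',
      inner_blochCurve_add hX w₀ w₁ h h', inner_blochCurve_add hX w₁ w₀ h' h, e1, e2]
    have e3 : (starRingEnd ℂ) n' * n * ((starRingEnd ℂ) n * n') = (M : ℂ) ^ 4 := by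
      linear_combination (starRingEnd ℂ) n' * n' * e1 + (M : ℂ) ^ 2 * e2
    push_cast
    linear_combination (-⟪toL2 (blochCurve (-zS) w₁ k), toL2 (blochCurve zS w₀ k)⟫_ℂ *
      ⟪toL2 (blochCurve zS w₀ k), toL2 (blochCurve (-zS) w₁ k)⟫_ℂ) * e3
  exact_mod_cast key

/-- The first generator of the dual lattice. -/
def q₁ : ℂ := 4 * Real.pi * I / Real.sqrt 3

/-- The second generator of the dual lattice. -/
def q₂ : ℂ := q₁ * ω

lemma q₁_eq : q₁ = ((4 * Real.pi / Real.sqrt 3 : ℝ) : ℂ) * I := by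
  rw [q₁]; push_cast; ring

lemma q₁_re : q₁.re = 0 := by rw [q₁_eq, re_ofReal_mul, I_re, mul_zero]

lemma q₁_im : q₁.im = 4 * Real.pi / Real.sqrt 3 := by rw [q₁_eq, im_ofReal_mul, I_im, mul_one]

lemma q₂_re : q₂.re = -2 * Real.pi := by
  rw [q₂, mul_re, q₁_re, q₁_im, omega_im]
  have : Real.sqrt 3 ≠ 0 := by simp
  field_simp; ring

lemma q₂_im : q₂.im = -2 * Real.pi / Real.sqrt 3 := by
  rw [q₂, mul_im, q₁_re, q₁_im, omega_re]
  ring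

lemma zmap_q₁ : zmap q₁ = 1 := by
  have := zmap_dual 1
  rwa [mul_one] at this

lemma zmap_q₂ : zmap q₂ = ω := zmap_dual ω

lemma blochGram_add_q₁ (w₀ w₁ : C(ℂ, ℂ × ℂ)) (k : ℂ) :
    blochGram w₀ w₁ (k + q₁) = blochGram w₀ w₁ k := by
  have hN : ∀ r : ℝ, ‖Complex.exp (-(r : ℂ) * q₁)‖ = 1 := by
    intro r
    rw [Complex.norm_exp, ← ofReal_neg, re_ofReal_mul, q₁_re, mul_zero, Real.exp_zero]
  have hq : ∀ c z, blochFactor c (k + q₁) z = -Complex.exp (-(c.im : ℂ) * q₁) *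
      Complex.exp (-(z.im : ℂ) * q₁) * blochFactor c k z := by
    intro c z
    rw [blochFactor_eq, blochFactor_eq, zmap_add, zmap_q₁, ← sub_sub, theta_sub_one, mul_add,
      mul_add, Complex.exp_add, Complex.exp_add]
    ring
  rw [blochGram_add (fun z => hN z.im) (M := 1) ((norm_neg _).trans (hN _))
    ((norm_neg _).trans (hN _)) w₀ w₁ (hq zS) (hq (-zS))]
  ring

lemma blochGram_add_q₂ (w₀ w₁ : C(ℂ, ℂ × ℂ)) (k : ℂ) :
    blochGram w₀ w₁ (k + q₂) =
      Real.exp (2 * (2 * Real.pi * ω.im + 4 * Real.pi * (zmap k).im)) * blochGram w₀ w₁ k := by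
  have hN : ∀ z : ℂ, ‖Complex.exp (-(z.im : ℂ) * q₂ + 2 * Real.pi * I * z)‖ = 1 := by
    intro z
    rw [Complex.norm_exp, add_re, ← ofReal_neg, re_ofReal_mul, q₂_re,
      show (2 * Real.pi * I * z : ℂ) = ((2 * Real.pi : ℝ) : ℂ) * (I * z) by push_cast; ring,
      re_ofReal_mul, I_mul_re, Real.exp_eq_one_iff]
    ring
  have hm : ‖-Complex.exp (-Real.pi * I * ω - 2 * Real.pi * I * zmap k)‖ =
      Real.exp (Real.pi * ω.im + 2 * Real.pi * (zmap k).im) := by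
    rw [norm_neg, Complex.norm_exp, show (-Real.pi * I * ω - 2 * Real.pi * I * zmap k : ℂ) =
      ((-Real.pi : ℝ) : ℂ) * (I * ω) - ((2 * Real.pi : ℝ) : ℂ) * (I * zmap k) by push_cast; ring,
      sub_re, re_ofReal_mul, re_ofReal_mul, I_mul_re, I_mul_re]
    congr 1; ring
  have hq : ∀ c z, blochFactor c (k + q₂) z =
      -Complex.exp (-Real.pi * I * ω - 2 * Real.pi * I * zmap k) *
      Complex.exp (-(c.im : ℂ) * q₂ + 2 * Real.pi * I * c) *
      Complex.exp (-(z.im : ℂ) * q₂ + 2 * Real.pi * I * z) * blochFactor c k z := by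
    intro c z
    rw [blochFactor_eq, blochFactor_eq, zmap_add, zmap_q₂, ← sub_sub, theta_sub_omega]
    have : Complex.exp (-Real.pi * I * ω + 2 * Real.pi * I * (z + c - zmap k)) =
      Complex.exp (-Real.pi * I * ω - 2 * Real.pi * I * zmap k) *
        Complex.exp (2 * Real.pi * I * c) * Complex.exp (2 * Real.pi * I * z) := by
      rw [← Complex.exp_add, ← Complex.exp_add]; ring_nf
    rw [this, mul_add, mul_add, Complex.exp_add, Complex.exp_add, Complex.exp_add, Complex.exp_add]
    ring
  rw [blochGram_add hN (M := Real.exp (Real.pi * ω.im + 2 * Real.pi * (zmap k).im))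
    (by rw [norm_mul, hm, hN, mul_one]) (by rw [norm_mul, hm, hN, mul_one]) w₀ w₁ (hq zS) (hq (-zS)),
    ← Real.exp_nat_mul]
  congr 2
  push_cast; ring

open scoped Laplacian

section Wirtinger
variable {f : ℂ → ℝ} {k : ℂ}

lemma laplacian_eq_fderiv_fderiv (hf : ContDiffAt ℝ 2 f k) :
    Δ f k = fderiv ℝ (fun p => fderiv ℝ f p 1) k 1 + fderiv ℝ (fun p => fderiv ℝ f p I) k I := by
  have hd : DifferentiableAt ℝ (fderiv ℝ f) k :=
    (hf.fderiv_right (m := 1) (by norm_num)).differentiableAt (by norm_num)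
  have h : ∀ v, fderiv ℝ (fun p => fderiv ℝ f p v) k v = fderiv ℝ (fderiv ℝ f) k v v := by
    intro v
    rw [fderiv_clm_apply hd (differentiableAt_const v)]
    simp
  rw [InnerProductSpace.laplacian_eq_iteratedFDeriv_complexPlane]
  simp [iteratedFDeriv_two_apply, h]

lemma re_dkbar_dk_eq_laplacian (hf : ContDiffAt ℝ 2 f k) :
    (dkbar (fun p => dk (fun q => (f q : ℂ)) p) k).re = 1 / 4 * Δ f k := by
  have hd : DifferentiableAt ℝ (fderiv ℝ f) k :=
    (hf.fderiv_right (m := 1) (by norm_num)).differentiableAt (by norm_num)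
  have hdv : ∀ v, DifferentiableAt ℝ (fun p => fderiv ℝ f p v) k := fun v =>
    hd.clm_apply (differentiableAt_const v)
  have h1 : (fun p => dk (fun q => (f q : ℂ)) p) =ᶠ[nhds k]
      fun p => ((fderiv ℝ f p 1 : ℂ) - I * (fderiv ℝ f p I : ℂ)) / 2 := by
    filter_upwards [hf.eventually (by simp)] with p hp
    have h2 : HasFDerivAt (fun q => (f q : ℂ)) (ofRealCLM.comp (fderiv ℝ f p)) p :=
      ofRealCLM.hasFDerivAt.comp p (hp.differentiableAt (by norm_num)).hasFDerivAt
    rw [dk, h2.fderiv]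
    rfl
  have h3 : HasFDerivAt (fun p => ((fderiv ℝ f p 1 : ℂ) - I * (fderiv ℝ f p I : ℂ)) / 2)
      ((2 : ℂ)⁻¹ • (ofRealCLM.comp (fderiv ℝ (fun p => fderiv ℝ f p 1) k) -
        I • ofRealCLM.comp (fderiv ℝ (fun p => fderiv ℝ f p I) k))) k := by
    have ha := ofRealCLM.hasFDerivAt.comp k (hdv 1).hasFDerivAt
    have hb := ofRealCLM.hasFDerivAt.comp k (hdv I).hasFDerivAt
    refine ((ha.sub (hb.const_smul I)).const_smul (2 : ℂ)⁻¹).congr_of_eventuallyEq ?_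
    refine Filter.Eventually.of_forall fun p => ?_
    simp [div_eq_inv_mul]
  rw [dkbar, h1.fderiv_eq, h3.fderiv, laplacian_eq_fderiv_fderiv hf]
  simp
  ring

end Wirtinger

section Cell

/-- The parametrisation of the dual cell. -/
def cellMap : ℂ →L[ℝ] ℂ := reCLM.smulRight q₁ + imCLM.smulRight q₂

lemma cellMap_apply (z : ℂ) : cellMap z = z.re * q₁ + z.im * q₂ := by
  simp [cellMap]

lemma det_cellMap : |cellMap.det| = 8 * Real.pi ^ 2 / Real.sqrt 3 := by
  have h3 : (0 : ℝ) < Real.sqrt 3 := by positivity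
  have h : cellMap.det = -(-8 * Real.pi ^ 2 / Real.sqrt 3) := by
    rw [ContinuousLinearMap.det, ← LinearMap.det_toMatrix Complex.basisOneI, Matrix.det_fin_two]
    simp [LinearMap.toMatrix_apply, cellMap_apply, q₁_re, q₁_im, q₂_re, q₂_im]
    ring
  rw [h, abs_of_nonneg (by rw [neg_mul, neg_div, neg_neg]; positivity)]
  ring

lemma injective_cellMap : Function.Injective cellMap := by
  have h3 : Real.sqrt 3 ≠ 0 := by simp
  have hpi := Real.pi_ne_zero
  refine (injective_iff_map_eq_zero cellMap).2 fun z hz => ?_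
  rw [cellMap_apply] at hz
  have hr := congrArg re hz
  have hi := congrArg im hz
  simp [q₁_re, q₁_im, q₂_re, q₂_im, hpi] at hr hi
  simp [hr, hpi, h3] at hi
  exact Complex.ext hi hr

lemma image_cellMap : FΛdual =
    cellMap '' (Set.Ioo (-(1 / 2)) (1 / 2) ×ℂ Set.Ioo (-(1 / 2)) (1 / 2)) := by
  ext k
  constructor
  · rintro ⟨s, t, h1, h2, h3, h4, rfl⟩
    exact ⟨⟨s, t⟩, ⟨⟨h1, h2⟩, h3, h4⟩, by rw [cellMap_apply]; rfl⟩
  · rintro ⟨z, ⟨⟨h1, h2⟩, h3, h4⟩, rfl⟩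
    exact ⟨z.re, z.im, h1, h2, h3, h4, by rw [cellMap_apply]; rfl⟩

lemma measurableSet_cell : MeasurableSet (Set.Ioo (-(1 / 2) : ℝ) (1 / 2) ×ℂ
    Set.Ioo (-(1 / 2) : ℝ) (1 / 2)) :=
  (measurable_re measurableSet_Ioo).inter (measurable_im measurableSet_Ioo)

lemma measurableSet_FΛdual : MeasurableSet FΛdual := by
  rw [image_cellMap]
  exact measurableSet_cell.image_of_continuousOn_injOn cellMap.continuous.continuousOn
    injective_cellMap.injOn

lemma FΛdual_subset : ∃ R, FΛdual ⊆ Metric.closedBall (0 : ℂ) R := by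
  refine ⟨‖cellMap‖ * 1, ?_⟩
  rw [image_cellMap]
  rintro _ ⟨z, ⟨⟨h1, h2⟩, h3, h4⟩, rfl⟩
  rw [mem_closedBall_zero_iff]
  refine (cellMap.le_opNorm z).trans (mul_le_mul_of_nonneg_left ?_ (norm_nonneg _))
  refine (Complex.norm_le_abs_re_add_abs_im z).trans ?_
  have := abs_le.2 ⟨h1.le, h2.le⟩
  have := abs_le.2 ⟨h3.le, h4.le⟩
  linarith

lemma integrableOn_FΛdual {φ : ℂ → ℝ} (hφ : Continuous φ) : IntegrableOn φ FΛdual := by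
  obtain ⟨R, hR⟩ := FΛdual_subset
  exact (hφ.continuousOn.integrableOn_compact (isCompact_closedBall 0 R)).mono_set hR

lemma setIntegral_FΛdual (φ : ℂ → ℝ) : ∫ k in FΛdual, φ k =
    8 * Real.pi ^ 2 / Real.sqrt 3 * ∫ p in Set.Ioo (-(1 / 2) : ℝ) (1 / 2) ×ˢ
      Set.Ioo (-(1 / 2) : ℝ) (1 / 2), φ (p.1 * q₁ + p.2 * q₂) := by
  rw [image_cellMap, integral_image_eq_integral_abs_det_fderiv_smul volume measurableSet_cell
    (fun z _ => cellMap.hasFDerivAt.hasFDerivWithinAt) injective_cellMap.injOn]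
  simp only [det_cellMap, smul_eq_mul, integral_const_mul]
  rw [← (Complex.volume_preserving_equiv_real_prod).setIntegral_preimage_emb
    Complex.measurableEquivRealProd.measurableEmbedding]
  congr 1

lemma integral_fderiv_segment {f : ℂ → ℝ} (hf : ContDiff ℝ 1 f) {p : ℂ} (h : ∀ k, f (k + p) = f k)
    (c : ℂ) : ∫ s in Set.Ioo (-(1 / 2) : ℝ) (1 / 2), fderiv ℝ f (s * p + c) p = 0 := by
  rw [← integral_Ioc_eq_integral_Ioo, ← intervalIntegral.integral_of_le (by norm_num)]
  have hd : ∀ s : ℝ, HasDerivAt (fun s : ℝ => f (s * p + c)) (fderiv ℝ f (s * p + c) p) s := by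
    intro s
    have h1 : HasDerivAt (fun s : ℝ => (s : ℂ) * p + c) p s := by
      simpa using (((hasDerivAt_id s).ofReal_comp).mul_const p).add_const c
    exact ((hf.differentiable (by norm_num) _).hasFDerivAt).comp_hasDerivAt s h1
  have hc : Continuous fun s : ℝ => fderiv ℝ f (s * p + c) p := by
    have := hf.continuous_fderiv (by norm_num)
    fun_prop
  rw [intervalIntegral.integral_eq_sub_of_hasDerivAt (fun s _ => hd s)
    (hc.intervalIntegrable _ _), sub_eq_zero, ← h ((-(1 / 2) : ℝ) * p + c)]
  congr 1
  push_cast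
  ring

lemma setIntegral_fderiv_eq_zero {f : ℂ → ℝ} (hf : ContDiff ℝ 1 f)
    (h₁ : ∀ k, f (k + q₁) = f k) (h₂ : ∀ k, f (k + q₂) = f k) :
    (∫ k in FΛdual, fderiv ℝ f k 1 = 0) ∧ ∫ k in FΛdual, fderiv ℝ f k I = 0 := by
  have hfc := hf.continuous_fderiv (by norm_num)
  have hcirc : ∀ v, IntegrableOn (fun p : ℝ × ℝ => fderiv ℝ f (p.1 * q₁ + p.2 * q₂) v)
      (Set.Ioo (-(1 / 2) : ℝ) (1 / 2) ×ˢ Set.Ioo (-(1 / 2) : ℝ) (1 / 2))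
      (volume.prod volume) := by
    intro v
    have hc : Continuous fun p : ℝ × ℝ => fderiv ℝ f (p.1 * q₁ + p.2 * q₂) v := by fun_prop
    exact (hc.continuousOn.integrableOn_compact
      (isCompact_Icc.prod isCompact_Icc)).mono_set
      (Set.prod_mono Set.Ioo_subset_Icc_self Set.Ioo_subset_Icc_self)
  have e₁ : ∫ k in FΛdual, fderiv ℝ f k q₁ = 0 := by
    rw [setIntegral_FΛdual, Measure.volume_eq_prod, ← Measure.prod_restrict, integral_prod_symm _ (by
      rw [Measure.prod_restrict]; exact hcirc q₁)]
    simp only [integral_fderiv_segment hf h₁, integral_zero, mul_zero]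
  have e₂ : ∫ k in FΛdual, fderiv ℝ f k q₂ = 0 := by
    rw [setIntegral_FΛdual, Measure.volume_eq_prod, setIntegral_prod _ (hcirc q₂)]
    simp_rw [add_comm _ ((_ : ℂ) * q₂)]
    simp only [integral_fderiv_segment hf h₂, integral_zero, mul_zero]
  have h3 : Real.sqrt 3 ≠ 0 := by simp
  have hpi := Real.pi_ne_zero
  have eI : I = (Real.sqrt 3 / (4 * Real.pi)) • q₁ := by
    apply Complex.ext
    · rw [smul_re, q₁_re, smul_zero, I_re]
    · rw [smul_im, q₁_im, I_im, smul_eq_mul]; field_simp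
  have e1 : (1 : ℂ) = (-1 / (2 * Real.pi)) • q₂ + (-1 / (4 * Real.pi)) • q₁ := by
    apply Complex.ext
    · rw [add_re, smul_re, smul_re, q₁_re, q₂_re, one_re, smul_eq_mul, smul_eq_mul]; field_simp
      ring
    · rw [add_im, smul_im, smul_im, q₁_im, q₂_im, one_im, smul_eq_mul, smul_eq_mul]; field_simp
      ring
  constructor
  · have : ∀ k, fderiv ℝ f k 1 = (-1 / (2 * Real.pi)) * fderiv ℝ f k q₂ +
        (-1 / (4 * Real.pi)) * fderiv ℝ f k q₁ := by
      intro k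
      rw [e1, map_add, map_smul, map_smul]
      rfl
    simp_rw [this]
    rw [integral_add ((integrableOn_FΛdual (by fun_prop)).const_mul _)
      ((integrableOn_FΛdual (by fun_prop)).const_mul _), integral_const_mul, integral_const_mul,
      e₁, e₂]
    simp
  · rw [eI]
    simp only [map_smul, smul_eq_mul]
    rw [integral_const_mul, e₁, mul_zero]

lemma setIntegral_laplacian_eq_zero {f : ℂ → ℝ} (hf : ContDiff ℝ 2 f)
    (h₁ : ∀ k, f (k + q₁) = f k) (h₂ : ∀ k, f (k + q₂) = f k) :
    ∫ k in FΛdual, Δ f k = 0 := by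
  have hfd : ∀ v, ContDiff ℝ 1 fun p => fderiv ℝ f p v := fun v =>
    (hf.fderiv_right (m := 1) (by norm_num)).clm_apply contDiff_const
  have hper : ∀ p, (∀ k, f (k + p) = f k) → ∀ v k, fderiv ℝ f (k + p) v = fderiv ℝ f k v := by
    intro p hp v k
    rw [← fderiv_comp_add_right, show (fun x => f (x + p)) = f from funext hp]
  simp_rw [laplacian_eq_fderiv_fderiv hf.contDiffAt]
  have c : ∀ v, Continuous fun k => fderiv ℝ (fun p => fderiv ℝ f p v) k v := fun v =>
    ((hfd v).continuous_fderiv (by norm_num)).clm_apply continuous_const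
  rw [integral_add (integrableOn_FΛdual (c 1)) (integrableOn_FΛdual (c I)),
    (setIntegral_fderiv_eq_zero (hfd 1) (hper _ h₁ 1) (hper _ h₂ 1)).1,
    (setIntegral_fderiv_eq_zero (hfd I) (hper _ h₁ I) (hper _ h₂ I)).2, add_zero]

lemma volume_FΛdual : ∫ _k in FΛdual, (1 : ℝ) = 8 * Real.pi ^ 2 / Real.sqrt 3 := by
  rw [setIntegral_FΛdual, Measure.volume_eq_prod]
  simp
  norm_num

end Cell

lemma zmap_im (k : ℂ) : (zmap k).im = -(Real.sqrt 3 / (4 * Real.pi)) * k.re := by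
  have h : zmap k = ((-(Real.sqrt 3 / (4 * Real.pi)) : ℝ) : ℂ) * (I * k) := by
    have hpi : (Real.pi : ℂ) ≠ 0 := by exact_mod_cast Real.pi_ne_zero
    rw [zmap]
    push_cast
    field_simp
    rw [I_sq]
    ring
  rw [h, im_ofReal_mul, I_mul_im]

/-- The theta function in the quasi-momentum variable. -/
def thetaDual (k : ℂ) : ℂ := theta (zmap k)

lemma differentiable_thetaDual : Differentiable ℂ thetaDual :=
  differentiable_theta.comp differentiable_zmap

lemma thetaDual_eq_zero_iff {k : ℂ} : thetaDual k = 0 ↔ k ∈ Λdual := by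
  rw [thetaDual, theta_eq_zero_iff, mem_dual_iff]

lemma thetaDual_zero : thetaDual 0 = 0 := by rw [thetaDual, zmap_zero, theta_zero]

lemma isClosed_Λdual : IsClosed Λdual := by
  have h : Λdual = thetaDual ⁻¹' {0} := by
    ext k; exact thetaDual_eq_zero_iff.symm
  rw [h]
  exact isClosed_singleton.preimage differentiable_thetaDual.continuous

lemma mem_Λdual_iff_exists {p : ℂ} : p ∈ Λdual ↔ ∃ m n : ℤ, p = m * q₂ + n * q₁ := by
  constructor
  · rintro ⟨m, n, rfl⟩; exact ⟨m, n, by rw [q₂, q₁]; ring⟩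
  · rintro ⟨m, n, rfl⟩; exact ⟨m, n, by rw [q₂, q₁]; ring⟩

lemma eq_zero_of_mem_Λdual_of_mem_FΛdual {k : ℂ} (h : k ∈ Λdual) (h' : k ∈ FΛdual) : k = 0 := by
  obtain ⟨m, n, hk⟩ := mem_Λdual_iff_exists.1 h
  rw [image_cellMap] at h'
  obtain ⟨z, ⟨⟨h1, h2⟩, h3, h4⟩, rfl⟩ := h'
  have hz : z = ⟨n, m⟩ := by
    apply injective_cellMap
    rw [hk, cellMap_apply]
    push_cast
    ring
  have key : ∀ n : ℤ, -(1 / 2 : ℝ) < n → (n : ℝ) < 1 / 2 → (n : ℝ) = 0 := by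
    intro n h1 h2
    have h3 : (-1 : ℝ) < n := by linarith
    have h4 : (n : ℝ) < 1 := by linarith
    have h5 : -1 < n := by exact_mod_cast h3
    have h6 : n < 1 := by exact_mod_cast h4
    have h7 : n = 0 := by omega
    simp [h7]
  rw [hz] at h1 h2 h3 h4
  rw [hz, show (⟨n, m⟩ : ℂ) = 0 from Complex.ext (key n h1 h2) (key m h3 h4), map_zero]

/-- The quotient of `thetaDual` by its zero at the origin. -/
def thetaSlope : ℂ → ℂ := dslope thetaDual 0

lemma differentiable_thetaSlope : Differentiable ℂ thetaSlope :=
  differentiableOn_univ.1 ((Complex.differentiableOn_dslope Filter.univ_mem).2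
    differentiable_thetaDual.differentiableOn)

lemma thetaDual_eq_mul (k : ℂ) : thetaDual k = k * thetaSlope k := by
  have h := sub_smul_dslope thetaDual 0 k
  rw [thetaDual_zero, sub_zero, sub_zero] at h
  exact h.symm

lemma thetaSlope_zero_ne_zero : thetaSlope 0 ≠ 0 := by
  have hz : zmap = fun k => zmap 1 * k := by ext k; simp [zmap]; ring
  have hκ : zmap 1 ≠ 0 := by
    intro h0
    have := eq_dual_zmap 1
    rw [h0, mul_zero] at this
    exact one_ne_zero this
  have h1 : HasDerivAt zmap (zmap 1) 0 := by
    conv => enter [1]; rw [hz]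
    simpa using (hasDerivAt_id (0 : ℂ)).const_mul (zmap 1)
  have h2 : HasDerivAt thetaDual (deriv theta 0 * zmap 1) 0 := by
    refine HasDerivAt.comp (h₂ := theta) (h := zmap) 0 ?_ h1
    rw [zmap_zero]
    exact (differentiable_theta 0).hasDerivAt
  rw [thetaSlope, dslope_same, h2.deriv]
  exact mul_ne_zero deriv_theta_zero_ne_zero hκ

lemma norm_thetaDual_add_q₁ (k : ℂ) : ‖thetaDual (k + q₁)‖ = ‖thetaDual k‖ := by
  rw [thetaDual, zmap_add, zmap_q₁, theta_add_one, norm_neg, thetaDual]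

lemma norm_thetaDual_add_q₂ (k : ℂ) : ‖thetaDual (k + q₂)‖ =
    Real.exp (Real.pi * ω.im + 2 * Real.pi * (zmap k).im) * ‖thetaDual k‖ := by
  rw [thetaDual, zmap_add, zmap_q₂, theta_add_omega, norm_mul, norm_neg, Complex.norm_exp,
    show (-Real.pi * I * ω - 2 * Real.pi * I * zmap k : ℂ) =
      ((-Real.pi : ℝ) : ℂ) * (I * ω) - ((2 * Real.pi : ℝ) : ℂ) * (I * zmap k) by push_cast; ring,
    sub_re, re_ofReal_mul, re_ofReal_mul, I_mul_re, I_mul_re, thetaDual]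
  congr 2
  ring

/-- The quadratic weight compensating the quasi-periodicity of the theta function. -/
def quadWeight (k : ℂ) : ℝ := Real.sqrt 3 / (4 * Real.pi) * k.re ^ 2

lemma contDiff_quadWeight : ContDiff ℝ 2 quadWeight :=
  contDiff_const.mul (reCLM.contDiff.pow 2)

lemma laplacian_quadWeight (k : ℂ) : Δ quadWeight k = Real.sqrt 3 / (2 * Real.pi) := by
  have h1 : ∀ p, HasFDerivAt quadWeight
      ((Real.sqrt 3 / (4 * Real.pi)) • ((2 * p.re) • reCLM)) p := by
    intro p
    have h : HasFDerivAt (fun p : ℂ => Real.sqrt 3 / (4 * Real.pi) * p.re ^ 2) _ p :=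
      ((reCLM.hasFDerivAt (x := p)).pow 2).const_mul (Real.sqrt 3 / (4 * Real.pi))
    refine h.congr_fderiv ?_
    simp
  have h2 : ∀ v, (fun p => fderiv ℝ quadWeight p v) =
      fun p => Real.sqrt 3 / (4 * Real.pi) * (2 * v.re) * p.re := by
    intro v
    ext p
    rw [(h1 p).fderiv]
    simp
    ring
  have h3 : ∀ v, fderiv ℝ (fun p => fderiv ℝ quadWeight p v) k v =
      Real.sqrt 3 / (4 * Real.pi) * (2 * v.re) * v.re := by
    intro v
    have h : HasFDerivAt (fun p : ℂ => Real.sqrt 3 / (4 * Real.pi) * (2 * v.re) * p.re) _ k :=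
      (reCLM.hasFDerivAt (x := k)).const_mul (Real.sqrt 3 / (4 * Real.pi) * (2 * v.re))
    rw [h2 v, h.fderiv]
    simp
  rw [laplacian_eq_fderiv_fderiv contDiff_quadWeight.contDiffAt, h3, h3, one_re, I_re]
  ring

lemma quadWeight_add_q₁ (k : ℂ) : quadWeight (k + q₁) = quadWeight k := by
  rw [quadWeight, add_re, q₁_re, add_zero, quadWeight]

lemma quadWeight_add_q₂ (k : ℂ) : quadWeight (k + q₂) =
    quadWeight k + (2 * Real.pi * ω.im + 4 * Real.pi * (zmap k).im) := by
  have hpi := Real.pi_ne_zero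
  rw [quadWeight, add_re, q₂_re, quadWeight, zmap_im, omega_im]
  field_simp
  ring

section Potential
variable {γ γ₁ : ℂ → ℝ}

/-- The logarithm of `γ` minus its singular and quasi-periodic part. -/
def regularPart (γ γ₁ : ℂ → ℝ) (k : ℂ) : ℝ :=
  if thetaDual k = 0 then Real.log (γ₁ 0) - 2 * Real.log ‖thetaSlope 0‖
  else Real.log (γ k) - 2 * Real.log ‖thetaDual k‖ - quadWeight k

lemma regularPart_of_notMem {k : ℂ} (hk : k ∉ Λdual) : regularPart γ γ₁ k =
    Real.log (γ k) - 2 * Real.log ‖thetaDual k‖ - quadWeight k :=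
  if_neg fun h => hk (thetaDual_eq_zero_iff.1 h)

lemma regularPart_add_q₁ (h₁ : ∀ k, γ (k + q₁) = γ k) (k : ℂ) :
    regularPart γ γ₁ (k + q₁) = regularPart γ γ₁ k := by
  have h : thetaDual (k + q₁) = 0 ↔ thetaDual k = 0 := by
    rw [← norm_eq_zero, norm_thetaDual_add_q₁, norm_eq_zero]
  rw [regularPart, regularPart, norm_thetaDual_add_q₁, quadWeight_add_q₁, h₁]
  simp only [h]

lemma regularPart_add_q₂ (hpos : ∀ k ∉ Λdual, 0 < γ k)
    (h₂ : ∀ k, γ (k + q₂) =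
      Real.exp (2 * (2 * Real.pi * ω.im + 4 * Real.pi * (zmap k).im)) * γ k) (k : ℂ) :
    regularPart γ γ₁ (k + q₂) = regularPart γ γ₁ k := by
  have h : thetaDual (k + q₂) = 0 ↔ thetaDual k = 0 := by
    rw [← norm_eq_zero, norm_thetaDual_add_q₂, mul_eq_zero, norm_eq_zero,
      or_iff_right (Real.exp_pos _).ne']
  by_cases hk : thetaDual k = 0
  · rw [regularPart, regularPart, if_pos hk, if_pos (h.2 hk)]
  · have hγ := (hpos k fun hk' => hk (thetaDual_eq_zero_iff.2 hk')).ne'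
    rw [regularPart, regularPart, if_neg hk, if_neg (mt h.1 hk), norm_thetaDual_add_q₂,
      quadWeight_add_q₂, h₂, Real.log_mul (Real.exp_pos _).ne' hγ,
      Real.log_mul (Real.exp_pos _).ne' (norm_ne_zero_iff.2 hk), Real.log_exp, Real.log_exp]
    ring

lemma harmonicAt_log_norm_thetaDual {k : ℂ} (hk : k ∉ Λdual) :
    InnerProductSpace.HarmonicAt (fun p => Real.log ‖thetaDual p‖) k :=
  (differentiable_thetaDual.analyticAt k).harmonicAt_log_norm
    fun h => hk (thetaDual_eq_zero_iff.1 h)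

lemma contDiffAt_log {k : ℂ} (hγ : ContDiff ℝ 2 γ) (h : 0 < γ k) :
    ContDiffAt ℝ 2 (fun p => Real.log (γ p)) k :=
  hγ.contDiffAt.log h.ne'

lemma eventually_notMem_Λdual {k : ℂ} (hk : k ∉ Λdual) : ∀ᶠ p in nhds k, p ∉ Λdual :=
  isClosed_Λdual.isOpen_compl.mem_nhds hk

lemma contDiffAt_regularPart_of_notMem (hγ : ContDiff ℝ 2 γ) (hpos : ∀ k ∉ Λdual, 0 < γ k) {k : ℂ}
    (hk : k ∉ Λdual) : ContDiffAt ℝ 2 (regularPart γ γ₁) k := by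
  have h : ContDiffAt ℝ 2
      (fun p => Real.log (γ p) - 2 * Real.log ‖thetaDual p‖ - quadWeight p) k :=
    ((contDiffAt_log hγ (hpos k hk)).sub
      (contDiffAt_const.mul (harmonicAt_log_norm_thetaDual hk).1)).sub
      contDiff_quadWeight.contDiffAt
  refine h.congr_of_eventuallyEq ?_
  filter_upwards [eventually_notMem_Λdual hk] with p hp using regularPart_of_notMem hp

lemma contDiffAt_regularPart_zero (hγ₁ : ContDiff ℝ 2 γ₁) (hpos₁ : 0 < γ₁ 0)
    (heq : ∀ k, γ k = ‖k‖ ^ 2 * γ₁ k) : ContDiffAt ℝ 2 (regularPart γ γ₁) 0 := by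
  have hs := (differentiable_thetaSlope.analyticAt 0).harmonicAt_log_norm thetaSlope_zero_ne_zero
  have h : ContDiffAt ℝ 2
      (fun p => Real.log (γ₁ p) - 2 * Real.log ‖thetaSlope p‖ - quadWeight p) 0 :=
    ((contDiffAt_log hγ₁ hpos₁).sub (contDiffAt_const.mul hs.1)).sub
      contDiff_quadWeight.contDiffAt
  refine h.congr_of_eventuallyEq ?_
  filter_upwards [hγ₁.continuous.continuousAt.eventually_ne hpos₁.ne',
    differentiable_thetaSlope.continuous.continuousAt.eventually_ne thetaSlope_zero_ne_zero]
    with p hp1 hp2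
  by_cases hp : p = 0
  · rw [hp, regularPart, if_pos thetaDual_zero, quadWeight, zero_re]
    ring
  · have hn : ‖p‖ ≠ 0 := norm_ne_zero_iff.2 hp
    rw [regularPart, if_neg (by rw [thetaDual_eq_mul]; exact mul_ne_zero hp hp2), heq,
      thetaDual_eq_mul, norm_mul, Real.log_mul (pow_ne_zero 2 hn) hp1,
      Real.log_mul hn (norm_ne_zero_iff.2 hp2), Real.log_pow]
    push_cast
    ring

lemma contDiff_regularPart (hγ : ContDiff ℝ 2 γ) (hγ₁ : ContDiff ℝ 2 γ₁)
    (hpos : ∀ k ∉ Λdual, 0 < γ k) (hpos₁ : 0 < γ₁ 0) (heq : ∀ k, γ k = ‖k‖ ^ 2 * γ₁ k)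
    (h₁ : ∀ k, γ (k + q₁) = γ k)
    (h₂ : ∀ k, γ (k + q₂) =
      Real.exp (2 * (2 * Real.pi * ω.im + 4 * Real.pi * (zmap k).im)) * γ k) :
    ContDiff ℝ 2 (regularPart γ γ₁) := by
  have p₁ : Function.Periodic (regularPart γ γ₁) q₁ := regularPart_add_q₁ h₁
  have p₂ : Function.Periodic (regularPart γ γ₁) q₂ := regularPart_add_q₂ hpos h₂
  rw [contDiff_iff_contDiffAt]
  intro k
  by_cases hk : k ∈ Λdual
  · obtain ⟨m, n, hmn⟩ := mem_Λdual_iff_exists.1 hk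
    have hp : Function.Periodic (regularPart γ γ₁) k := by
      rw [hmn]
      exact (p₂.int_mul m).add_period (p₁.int_mul n)
    have h0 : ContDiffAt ℝ 2 (regularPart γ γ₁) (k - k) := by
      rw [sub_self]; exact contDiffAt_regularPart_zero hγ₁ hpos₁ heq
    have := h0.comp (f := fun p => p - k) k (contDiffAt_id.sub contDiffAt_const)
    rwa [show regularPart γ γ₁ ∘ (fun p => p - k) = regularPart γ γ₁ from
      funext fun p => hp.sub_eq p] at this
  · exact contDiffAt_regularPart_of_notMem hγ hpos hk

lemma laplacian_log_eq (hγ : ContDiff ℝ 2 γ) (hpos : ∀ k ∉ Λdual, 0 < γ k) {k : ℂ}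
    (hk : k ∉ Λdual) : Δ (fun p => Real.log (γ p)) k =
      Δ (regularPart γ γ₁) k + Real.sqrt 3 / (2 * Real.pi) := by
  have hh := harmonicAt_log_norm_thetaDual hk
  have hN := contDiffAt_regularPart_of_notMem (γ₁ := γ₁) hγ hpos hk
  have hL : ContDiffAt ℝ 2 ((2 : ℝ) • fun p => Real.log ‖thetaDual p‖) k := hh.1.const_smul (2 : ℝ)
  have hNL : ContDiffAt ℝ 2
      (regularPart γ γ₁ + (2 : ℝ) • fun p => Real.log ‖thetaDual p‖) k := hN.add hL
  have h : (fun p => Real.log (γ p)) =ᶠ[nhds k]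
      (regularPart γ γ₁ + (2 : ℝ) • fun p => Real.log ‖thetaDual p‖) + quadWeight := by
    filter_upwards [eventually_notMem_Λdual hk] with p hp
    simp only [Pi.add_apply, Pi.smul_apply, smul_eq_mul, regularPart_of_notMem hp]
    ring
  rw [(InnerProductSpace.laplacian_congr_nhds h).eq_of_nhds,
    hNL.laplacian_add contDiff_quadWeight.contDiffAt, hN.laplacian_add hL,
    InnerProductSpace.laplacian_smul _ hh.1, hh.2.eq_of_nhds, laplacian_quadWeight]
  simp

lemma tendsto_integral_punctured_cell {φ : ℂ → ℝ} (hφ : Continuous φ) :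
    Filter.Tendsto (fun ε : ℝ => ∫ k in FΛdual \ Metric.ball (0 : ℂ) ε, φ k)
      (nhdsWithin 0 (Set.Ioi 0)) (nhds (∫ k in FΛdual, φ k)) := by
  have hc : AECover (volume.restrict FΛdual) (nhdsWithin (0 : ℝ) (Set.Ioi 0))
      fun ε => (Metric.ball (0 : ℂ) ε)ᶜ := by
    refine ⟨?_, fun ε => measurableSet_ball.compl⟩
    refine ae_restrict_of_ae ?_
    filter_upwards [(Set.countable_singleton (0 : ℂ)).ae_notMem volume] with x hx
    have hx' : 0 < ‖x‖ := norm_pos_iff.2 hx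
    filter_upwards [nhdsWithin_le_nhds (eventually_lt_nhds hx')] with ε hε
    simpa using hε.le
  have := hc.integral_tendsto_of_countably_generated (integrableOn_FΛdual hφ)
  refine this.congr fun ε => ?_
  rw [Measure.restrict_restrict measurableSet_ball.compl, Set.inter_comm, Set.sdiff_eq]

lemma tendsto_integral_curvature (hγ : ContDiff ℝ 2 γ) (hγ₁ : ContDiff ℝ 2 γ₁)
    (hpos : ∀ k ∉ Λdual, 0 < γ k) (hpos₁ : 0 < γ₁ 0) (heq : ∀ k, γ k = ‖k‖ ^ 2 * γ₁ k)
    (h₁ : ∀ k, γ (k + q₁) = γ k)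
    (h₂ : ∀ k, γ (k + q₂) =
      Real.exp (2 * (2 * Real.pi * ω.im + 4 * Real.pi * (zmap k).im)) * γ k) {H : ℂ → ℂ}
    (hH : ∀ k ∉ Λdual, (H k).re =
      (dkbar (fun p => dk (fun q => ((Real.log (γ q) : ℝ) : ℂ)) p) k).re) :
    Filter.Tendsto (fun ε : ℝ => ∫ k in FΛdual \ Metric.ball (0 : ℂ) ε, (H k).re)
      (nhdsWithin 0 (Set.Ioi 0)) (nhds Real.pi) := by
  have hN := contDiff_regularPart hγ hγ₁ hpos hpos₁ heq h₁ h₂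
  have hfd : ∀ v, ContDiff ℝ 1 fun p => fderiv ℝ (regularPart γ γ₁) p v := fun v =>
    (hN.fderiv_right (m := 1) (by norm_num)).clm_apply contDiff_const
  have c : ∀ v, Continuous fun k =>
      fderiv ℝ (fun p => fderiv ℝ (regularPart γ γ₁) p v) k v := fun v =>
    ((hfd v).continuous_fderiv (by norm_num)).clm_apply continuous_const
  have hΔ : Continuous (Δ (regularPart γ γ₁)) := by
    rw [show Δ (regularPart γ γ₁) = _ from
      funext fun k => laplacian_eq_fderiv_fderiv hN.contDiffAt]
    exact (c 1).add (c I)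
  have hφ : Continuous fun k => 1 / 4 * (Δ (regularPart γ γ₁) k + Real.sqrt 3 / (2 * Real.pi)) := by
    fun_prop
  have hval : ∫ k in FΛdual, 1 / 4 * (Δ (regularPart γ γ₁) k + Real.sqrt 3 / (2 * Real.pi)) =
      Real.pi := by
    have hconst : ∫ _k in FΛdual, Real.sqrt 3 / (2 * Real.pi) =
        Real.sqrt 3 / (2 * Real.pi) * (8 * Real.pi ^ 2 / Real.sqrt 3) := by
      rw [← volume_FΛdual, ← integral_const_mul]
      simp only [mul_one]
    have h3 : Real.sqrt 3 ≠ 0 := by simp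
    have hpi := Real.pi_ne_zero
    rw [integral_const_mul, integral_add (integrableOn_FΛdual hΔ)
      (integrableOn_FΛdual continuous_const), setIntegral_laplacian_eq_zero hN
      (regularPart_add_q₁ h₁) (regularPart_add_q₂ hpos h₂), hconst]
    field_simp
    ring
  have hlim := tendsto_integral_punctured_cell hφ
  rw [hval] at hlim
  refine hlim.congr' ?_
  filter_upwards [self_mem_nhdsWithin] with ε hε
  refine setIntegral_congr_fun (measurableSet_FΛdual.diff measurableSet_ball) fun k hk => ?_
  have hk' : k ∉ Λdual := by
    intro h
    apply hk.2
    rw [eq_zero_of_mem_Λdual_of_mem_FΛdual h hk.1]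
    exact Metric.mem_ball_self hε
  change _ = (H k).re
  rw [hH k hk', re_dkbar_dk_eq_laplacian (contDiffAt_log hγ (hpos k hk')),
    laplacian_log_eq (γ₁ := γ₁) hγ hpos hk']

end Potential

lemma eq_zero_add_of_mem_kerPSet {Up Um : ℂ → ℂ} {α : ℂ} {u₀ : ℂ → ℂ × ℂ}
    (hu₀ : u₀ ∈ kerPSet Up Um α 0) : ∀ γ ∈ Λ, ∀ z, u₀ z = 0 → u₀ (z + γ) = 0 := by
  intro γ hγ z hz
  obtain ⟨⟨-, -, -, h1, h2⟩, -⟩ := hu₀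
  refine Prod.ext ?_ ?_
  · rw [h1 γ hγ z, hz]; simp
  · rw [h2 γ hγ z, hz]; simp

lemma inner_blochCurve_eq_integral {c c' k : ℂ} {w w' : C(ℂ, ℂ × ℂ)} {u u' : ℂ → ℂ × ℂ}
    (h : ∀ z, u z = blochFactor c k z • w z) (h' : ∀ z, u' z = blochFactor c' k z • w' z) :
    ∫ z in FΛ, ((u z).1 * (starRingEnd ℂ) (u' z).1 + (u z).2 * (starRingEnd ℂ) (u' z).2) =
      ⟪toL2 (blochCurve c' w' k), toL2 (blochCurve c w k)⟫_ℂ := by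
  rw [inner_blochCurve]
  congr 1
  ext z
  rw [← h, ← h', WithLp.prod_inner_apply]
  simp [RCLike.inner_apply]

/-- **the Chern number of the four-fold degenerate flat band equals −1:**
`lim_{ε→0⁺} ∫_{F_{Λ*}∖D(0,ε)} H dm = π`, i.e. `c₁(E) = (i/2π)∫ tr Θ = −1`. -/
theorem chern_number_eq_neg_one
    (U : ℂ → ℂ) (hU : IsTunnelling U)
    (hsym : ∀ z : ℂ, (starRingEnd ℂ) (U ((starRingEnd ℂ) z)) = -U (-z))
    (α : ℂ) (hα : ∀ k : ℂ, kerDim U (fun z => U (-z)) α k = 2)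
    (u₀ : ℂ → ℂ × ℂ) (hu₀ : u₀ ∈ kerPSet U (fun z => U (-z)) α 0) (hu₀ne : u₀ ≠ 0)
    (uu : Fin 2 → ℂ → ℂ → ℂ × ℂ)
    (huus : ∀ (j : Fin 2), ∀ k ∉ Λdual, ContDiff ℝ (⊤ : ℕ∞) (uu j k))
    (huu0 : ∀ k ∉ Λdual, ∀ z : ℂ, z + zS ∉ Λ → uu 0 k z = Fk k (z + zS) • u₀ z)
    (huu1 : ∀ k ∉ Λdual, ∀ z : ℂ, z - zS ∉ Λ → uu 1 k z = Fk k (z - zS) • u₀ z)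
    (G : ℂ → Matrix (Fin 2) (Fin 2) ℂ)
    (hG : ∀ (k : ℂ) (j l : Fin 2), G k j l = ∫ z in FΛ,
      ((uu j k z).1 * (starRingEnd ℂ) ((uu l k z).1) +
        (uu j k z).2 * (starRingEnd ℂ) ((uu l k z).2)))
    (g : ℂ → ℂ) (hg : ∀ k : ℂ, g k = (G k).det)
    (H : ℂ → ℂ)
    (hH : ∀ k : ℂ, H k = dkbar (fun p => dk (fun q => ((Real.log (g q).re : ℝ) : ℂ)) p) k) :
    Filter.Tendsto (fun ε : ℝ => ∫ k in FΛdual \ Metric.ball (0 : ℂ) ε, (H k).re)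
      (nhdsWithin 0 (Set.Ioi 0)) (nhds Real.pi) := by
  have hu₀c : Continuous u₀ := hu₀.1.1.continuous
  obtain ⟨W, hW, hWne, hWs, hWu⟩ :=
    exists_open_subset_fundDomain hu₀c hu₀ne (eq_zero_add_of_mem_kerPSet hu₀)
  obtain ⟨f₀, hf₀, h₀, hv₀⟩ := exists_theta_quotient zS hu₀c
    (fun k hk => (huus 0 k hk).continuous) huu0
  obtain ⟨f₁, hf₁, h₁, hv₁⟩ := exists_theta_quotient (-zS) hu₀c
    (fun k hk => (huus 1 k hk).continuous)
    (fun k hk z hz => by simpa only [sub_eq_add_neg] using huu1 k hk z (by rwa [sub_eq_add_neg]))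
  let w₀ : C(ℂ, ℂ × ℂ) := ⟨f₀, hf₀⟩
  let w₁ : C(ℂ, ℂ × ℂ) := ⟨f₁, hf₁⟩
  have hgγ : ∀ k ∉ Λdual, g k = (blochGram w₀ w₁ k : ℂ) := by
    intro k hk
    have e₀ : ∀ z, uu 0 k z = blochFactor zS k z • w₀ z := hv₀ k hk
    have e₁ : ∀ z, uu 1 k z = blochFactor (-zS) k z • w₁ z := hv₁ k hk
    rw [hg, Matrix.det_fin_two, hG, hG, hG, hG, inner_blochCurve_eq_integral e₀ e₀,
      inner_blochCurve_eq_integral e₀ e₁, inner_blochCurve_eq_integral e₁ e₀,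
      inner_blochCurve_eq_integral e₁ e₁, blochGram, ofReal_gramDet]
  have hd₀ : Differentiable ℂ fun k => toL2 (blochCurve zS w₀ k) :=
    toL2.differentiable.comp (differentiable_blochCurve zS w₀)
  have hd₁ : Differentiable ℂ fun k => toL2 (blochCurve (-zS) w₁ k) :=
    toL2.differentiable.comp (differentiable_blochCurve (-zS) w₁)
  have hds : Differentiable ℂ fun k => toL2 (blochSlope w₀ w₁ k) :=
    toL2.differentiable.comp (differentiable_blochSlope w₀ w₁)
  refine tendsto_integral_curvature (γ := blochGram w₀ w₁)
    (γ₁ := fun k => gramDet (toL2 (blochCurve zS w₀ k)) (toL2 (blochSlope w₀ w₁ k)))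
    (contDiff_gramDet hd₀ hd₁) (contDiff_gramDet hd₀ hds)
    (fun k hk => gramDet_pos (blochCurve_independent h₀ h₁ hW hWne hWs hWu hk))
    (gramDet_pos (blochSlope_independent h₀ h₁ hW hWne hWs hWu)) (fun k => ?_)
    (blochGram_add_q₁ w₀ w₁) (blochGram_add_q₂ w₀ w₁) (fun k hk => ?_)
  · rw [blochGram, blochCurve_eq_sub (w₀ := w₀) (w₁ := w₁) h₀ h₁, map_sub toL2, map_smul toL2,
      gramDet_sub_smul]
  · have h : (fun p => dk (fun q => ((Real.log (g q).re : ℝ) : ℂ)) p) =ᶠ[nhds k]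
        fun p => dk (fun q => ((Real.log (blochGram w₀ w₁ q) : ℝ) : ℂ)) p := by
      filter_upwards [eventually_notMem_Λdual hk] with p hp
      have h2 : (fun q => ((Real.log (g q).re : ℝ) : ℂ)) =ᶠ[nhds p]
          fun q => ((Real.log (blochGram w₀ w₁ q) : ℝ) : ℂ) := by
        filter_upwards [eventually_notMem_Λdual hp] with q hq
        rw [hgγ q hq, ofReal_re]
      rw [dk, dk, h2.fderiv_eq]
    rw [hH, dkbar, dkbar, h.fderiv_eq]

end TBG
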